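/- Let p1 > 3 be a prime with p1 ≡ 3 (mod 4), let m ≥ 1 and N = p1^m. Let p be a prime with gcd(p, N) = 1 such that f := ord_N(p) = φ(N)/2, and let q = p^f. Let χ be a multiplicative character of order N of the finite field F_q, let h be the class number of the imaginary quadratic field Q(√(−p1)), and set h0 = (f − h)/2. Then there exist integers b, c such that: (1) b ≢ 0 (mod p) and c ≢ 0 (mod p); (2) b² + p1·c² = 4·p^h; (3) b·p^{h0} ≡ −2 (mod p1); and (4) the Gauss sum satisfies g(χ) = ((b + c·i·√p1)/2)·p^{h0} or g(χ) = ((b − c·i·√p1)/2)·p^{h0} in the complex numbers (i.e., g(χ) is determined up to complex conjugation by this formula). -/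

import Mathlib

/-- Every prime number is a nonunit in some valuation subring of `ℂ`. -/
lemma ValuationSubring.exists_natCast_mem_nonunits (p : ℕ) (hp : p.Prime) :
    ∃ A : ValuationSubring ℂ, (p : ℂ) ∈ A.nonunits := by
  have hI : Ideal.span {((p : ℕ) : (Int.castRingHom ℂ).range)} ≠ ⊤ := by
    rw [Ne, Ideal.span_singleton_eq_top, isUnit_iff_exists_inv]
    rintro ⟨⟨_, b, rfl⟩, hb⟩
    have hb' : ((p * b : ℤ) : ℂ) = ((1 : ℤ) : ℂ) := by
      simpa [Subtype.ext_iff] using hb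
    have hb'' : (p : ℤ) * b = 1 := by exact_mod_cast hb'
    exact hp.one_lt.ne' (by
      have := Int.isUnit_iff.mp (IsUnit.of_mul_eq_one _ hb'')
      omega)
  obtain ⟨B, -, hB⟩ := Ideal.image_subset_nonunits_valuationSubring _ hI
  exact ⟨B, hB ⟨_, Ideal.subset_span rfl, by simp⟩⟩

lemma ValuationSubring.mem_of_isIntegral_int {L : Type*} [Field L] (A : ValuationSubring L)
    {x : L} (hx : IsIntegral ℤ x) : x ∈ A := by
  have hx' : IsIntegral A x := hx.tower_top
  obtain ⟨y, rfl⟩ := IsIntegrallyClosed.isIntegral_iff.mp hx'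
  exact y.2

lemma ValuationSubring.valuation_le_one_of_isIntegral {L : Type*} [Field L]
    (A : ValuationSubring L) {x : L} (hx : IsIntegral ℤ x) : A.valuation x ≤ 1 :=
  (A.valuation_le_one_iff x).mpr (A.mem_of_isIntegral_int hx)

/-- The reduction map to an algebraic closure of the residue field. -/
noncomputable def ValuationSubring.reduction {L : Type*} [Field L] (A : ValuationSubring L) :
    A →+* AlgebraicClosure (IsLocalRing.ResidueField A) :=
  (algebraMap _ _).comp (IsLocalRing.residue A)

lemma ValuationSubring.reduction_eq_zero_iff {L : Type*} [Field L] (A : ValuationSubring L)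
    (x : A) : A.reduction x = 0 ↔ A.valuation (x : L) < 1 := by
  rw [← A.valuation_lt_one_iff, ← IsLocalRing.residue_eq_zero_iff]
  simp [reduction]

lemma ValuationSubring.charP_reduction {L : Type*} [Field L] (A : ValuationSubring L)
    {p : ℕ} (hp : p.Prime) (hA : A.valuation (p : L) < 1) :
    CharP (AlgebraicClosure (IsLocalRing.ResidueField A)) p := by
  have h0 : ((p : ℕ) : AlgebraicClosure (IsLocalRing.ResidueField A)) = 0 := by
    have := (A.reduction_eq_zero_iff (p : A)).mpr (by simpa using hA)
    simpa using this
  have := Fact.mk hp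
  exact (CharP.charP_iff_prime_eq_zero hp).mpr h0

lemma ValuationSubring.valuation_intCast_lt_one_iff {L : Type*} [Field L]
    (A : ValuationSubring L) {p : ℕ} (hp : p.Prime) (hA : A.valuation (p : L) < 1) (n : ℤ) :
    A.valuation (n : L) < 1 ↔ (p : ℤ) ∣ n := by
  have := A.charP_reduction hp hA
  rw [← CharP.intCast_eq_zero_iff (AlgebraicClosure (IsLocalRing.ResidueField A)) p]
  have h := A.reduction_eq_zero_iff (n : A)
  simpa using h.symm

lemma ValuationSubring.valuation_intCast_eq_one {L : Type*} [Field L]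
    (A : ValuationSubring L) {p : ℕ} (hp : p.Prime) (hA : A.valuation (p : L) < 1) {n : ℤ}
    (hn : ¬ (p : ℤ) ∣ n) : A.valuation (n : L) = 1 := by
  rw [← A.valuation_intCast_lt_one_iff hp hA, not_lt] at hn
  exact le_antisymm ((A.valuation_le_one_iff _).mpr (intCast_mem A n)) hn

/-- If an integer has the same valuation as `p ^ k`, then it is exactly divisible by `p ^ k`. -/
lemma ValuationSubring.exists_eq_mul_pow_of_valuation {L : Type*} [Field L] [CharZero L]
    (A : ValuationSubring L) {p : ℕ} (hp : p.Prime) (hA : A.valuation (p : L) < 1) {n : ℤ} {k : ℕ}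
    (hn : A.valuation (n : L) = A.valuation (p : L) ^ k) :
    ∃ b : ℤ, n = b * (p : ℤ) ^ k ∧ ¬ (p : ℤ) ∣ b := by
  have hp0 : (p : L) ≠ 0 := Nat.cast_ne_zero.mpr hp.ne_zero
  have hv0 : 0 < A.valuation (p : L) := by
    rw [Valuation.pos_iff]; exact hp0
  have hn0 : n ≠ 0 := by
    rintro rfl
    simp only [Int.cast_zero, map_zero] at hn
    exact (pow_pos hv0 k).ne hn
  have hfin : FiniteMultiplicity (p : ℤ) n := by
    rw [Int.finiteMultiplicity_iff]
    exact ⟨by simpa using hp.one_lt.ne', hn0⟩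
  obtain ⟨b, hb, hpb⟩ := hfin.exists_eq_pow_mul_and_not_dvd
  have hvb := A.valuation_intCast_eq_one hp hA hpb
  rw [hb] at hn
  push_cast at hn
  rw [map_mul, map_pow, hvb, mul_one] at hn
  have : multiplicity (p : ℤ) n = k :=
    (pow_right_strictAnti₀ hv0 hA).injective hn
  exact ⟨b, by rw [← this, mul_comm]; exact hb, hpb⟩

lemma MulChar.isIntegral_apply {F R : Type*} [Field F] [Finite F] [CommRing R] (χ : MulChar F R)
    (x : F) : IsIntegral ℤ (χ x) := by
  have := Fintype.ofFinite F
  rcases eq_or_ne x 0 with rfl | hx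
  · rw [χ.map_zero]; exact isIntegral_zero
  · refine IsIntegral.of_pow (n := Fintype.card F - 1) ?_ ?_
    · have := Fintype.one_lt_card (α := F); omega
    · rw [← map_pow, FiniteField.pow_card_sub_one_eq_one x hx, map_one]
      exact isIntegral_one

lemma AddChar.isIntegral_apply {G R : Type*} [AddGroup G] [Finite G] [CommRing R]
    (ψ : AddChar G R) (x : G) : IsIntegral ℤ (ψ x) := by
  refine IsIntegral.of_pow (n := Nat.card G) Nat.card_pos ?_
  rw [← AddChar.map_nsmul_eq_pow, card_nsmul_eq_zero', AddChar.map_zero_eq_one]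
  exact isIntegral_one

lemma isIntegral_gaussSum {F R : Type*} [Field F] [Fintype F] [CommRing R] (χ : MulChar F R)
    (ψ : AddChar F R) : IsIntegral ℤ (gaussSum χ ψ) :=
  IsIntegral.sum _ fun x _ ↦ (χ.isIntegral_apply x).mul (ψ.isIntegral_apply x)

lemma isIntegral_jacobiSum {F R : Type*} [Field F] [Fintype F] [CommRing R] (χ φ : MulChar F R) :
    IsIntegral ℤ (jacobiSum χ φ) :=
  IsIntegral.sum _ fun x _ ↦ (χ.isIntegral_apply x).mul (φ.isIntegral_apply _)

open Polynomial in
lemma ValuationSubring.exists_teichmuller (A : ValuationSubring ℂ) {p : ℕ} [hp : Fact p.Prime]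
    (hA : A.valuation (p : ℂ) < 1) (F : Type*) [Field F] [Fintype F] [Algebra (ZMod p) F] :
    ∃ (ι : F →+* AlgebraicClosure (IsLocalRing.ResidueField A)) (ω : MulChar F ℂ),
      ∀ x (hx : ω x ∈ A), A.reduction ⟨ω x, hx⟩ = ι x := by
  classical
  have := A.charP_reduction hp.out hA
  let := ZMod.algebra (AlgebraicClosure (IsLocalRing.ResidueField A)) p
  have : Algebra.IsAlgebraic (ZMod p) F := Algebra.IsAlgebraic.of_finite _ _
  let ι : F →+* AlgebraicClosure (IsLocalRing.ResidueField A) :=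
    (IsAlgClosed.lift (R := ZMod p) (S := F) : F →ₐ[ZMod p] _).toRingHom
  obtain ⟨g, hg⟩ := IsCyclic.exists_generator (α := Fˣ)
  set n := Fintype.card Fˣ with hn
  have hnpos : 0 < n := Fintype.card_pos
  have hξ : IsPrimitiveRoot (Complex.exp (2 * Real.pi * Complex.I / n)) n :=
    Complex.isPrimitiveRoot_exp n hnpos.ne'
  have hξA := A.mem_of_isIntegral_int (hξ.isIntegral hnpos)
  have hξ' : IsPrimitiveRoot (⟨_, hξA⟩ : A) n :=
    IsPrimitiveRoot.of_map_of_injective (f := A.subtype) hξ Subtype.val_injective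
  have hprod := congrArg (fun P : A[X] ↦ (P.map A.reduction).eval (ι g))
    (X_pow_sub_one_eq_prod hnpos hξ')
  have hg1 : ι g ^ n = 1 := by
    rw [← map_pow, ← Units.val_pow_eq_pow_val, hn, pow_card_eq_one, Units.val_one, map_one]
  simp only [Polynomial.map_sub, Polynomial.map_pow, Polynomial.map_X, Polynomial.map_one,
    eval_sub, eval_pow, eval_X, eval_one, hg1, sub_self, Polynomial.map_prod, eval_prod,
    Polynomial.map_C, eval_C] at hprod
  obtain ⟨ζ, hζ, hζg⟩ := Finset.prod_eq_zero_iff.mp hprod.symm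
  rw [mem_nthRootsFinset hnpos] at hζ
  have hζ1 : (ζ : ℂ) ^ n = 1 := by exact_mod_cast congrArg Subtype.val hζ
  let u : ℂˣ := Units.ofPowEqOne (ζ : ℂ) n hζ1 hnpos.ne'
  have hu : u ∈ rootsOfUnity (Fintype.card Fˣ) ℂ := by
    rw [mem_rootsOfUnity]; ext; simp [u, ← hn]
  refine ⟨ι, MulChar.ofRootOfUnity hu hg, fun x hx ↦ ?_⟩
  rcases eq_or_ne x 0 with rfl | hx0
  · rw [map_zero ι, A.reduction_eq_zero_iff]
    simp [MulChar.map_zero]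
  · obtain ⟨j, hj⟩ := (mem_powers_iff_mem_zpowers.mpr (hg (Units.mk0 x hx0)))
    have hxj : x = (g : F) ^ j := by
      rw [← Units.val_pow_eq_pow_val]; simp only [] at hj; rw [hj]; rfl
    have : (⟨MulChar.ofRootOfUnity hu hg x, hx⟩ : A) = ζ ^ j := by
      ext
      simp only [hxj, map_pow, MulChar.ofRootOfUnity_spec]
      rfl
    rw [this, hxj, map_pow, map_pow, ← sub_eq_zero.mp hζg]

lemma FiniteField.sum_inv_mul_trace (p : ℕ) [hp : Fact p.Prime] (F : Type*) [Field F] [Fintype F]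
    [Algebra (ZMod p) F] :
    ∑ x : F, x⁻¹ * algebraMap (ZMod p) F (Algebra.trace (ZMod p) F x) = -1 := by
  classical
  have : FiniteDimensional (ZMod p) F := Module.Finite.of_finite
  obtain ⟨f, hf⟩ : ∃ f, Module.finrank (ZMod p) F = f + 1 :=
    Nat.exists_eq_succ_of_ne_zero Module.finrank_pos.ne'
  have hcard : Fintype.card F = p ^ (f + 1) := by
    rw [Module.card_eq_pow_finrank (K := ZMod p), ZMod.card, hf]
  simp_rw [FiniteField.algebraMap_trace_eq_sum_pow, hf, Nat.card_zmod, Finset.mul_sum]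
  rw [Finset.sum_comm, Finset.sum_range_succ']
  have h0 : ∑ x : F, x⁻¹ * x ^ p ^ 0 = -1 := by
    have : ∀ x : F, x⁻¹ * x ^ p ^ 0 = 1 - if x = 0 then 1 else 0 := by
      intro x
      split_ifs with hx
      · simp [hx]
      · simp [hx]
    simp_rw [this, Finset.sum_sub_distrib]
    simp
  rw [h0, add_eq_right]
  refine Finset.sum_eq_zero fun i hi ↦ ?_
  rw [Finset.mem_range] at hi
  have hp1 := hp.out.one_lt
  have h1 : 1 < p ^ (i + 1) := Nat.one_lt_pow (by omega) hp1
  have h2 : p ^ (i + 1) < p ^ (f + 1) := Nat.pow_lt_pow_right hp1 (by omega)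
  rw [← FiniteField.sum_pow_lt_card_sub_one F (p ^ (i + 1) - 1) (by omega)]
  refine Finset.sum_congr rfl fun x _ ↦ ?_
  rcases eq_or_ne x 0 with rfl | hx
  · rw [inv_zero, zero_mul, zero_pow (by omega)]
  · obtain ⟨n, hn⟩ : ∃ n, p ^ (i + 1) = n + 1 := ⟨_, (Nat.sub_add_cancel h1.le).symm⟩
    rw [hn, Nat.add_sub_cancel, pow_succ', inv_mul_cancel_left₀ hx]

lemma ValuationSubring.reduction_eq_one_of_pow_eq_one {L : Type*} [Field L]
    (A : ValuationSubring L) {p : ℕ} (hp : p.Prime) (hA : A.valuation (p : L) < 1) {k : ℕ} {z : A}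
    (hz : z ^ p ^ k = 1) : A.reduction z = 1 := by
  have := A.charP_reduction hp hA
  have := Fact.mk hp
  have h := congrArg A.reduction hz
  rw [map_pow, map_one] at h
  have := (ExpChar.pow_prime_pow_mul_eq_one_iff p k 1 (A.reduction z)).mp (by simpa using h)
  simpa using this

/-- The Gauss sum of the inverse of the Teichmüller character has the same valuation as
`ζ - 1`. -/
lemma ValuationSubring.valuation_gaussSum_teichmuller_inv (A : ValuationSubring ℂ) {p : ℕ}
    [hp : Fact p.Prime] (hA : A.valuation (p : ℂ) < 1) {F : Type*} [Field F] [Fintype F]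
    [Algebra (ZMod p) F] (hF : 2 < Fintype.card F)
    (ι : F →+* AlgebraicClosure (IsLocalRing.ResidueField A)) (ω : MulChar F ℂ)
    (hω : ∀ x (hx : ω x ∈ A), A.reduction ⟨ω x, hx⟩ = ι x) {ζ : ℂ} (hζ : ζ ^ p = 1)
    (ψ : AddChar F ℂ) (hψ : ∀ x, ψ x = ζ ^ (Algebra.trace (ZMod p) F x).val) :
    A.valuation (gaussSum ω⁻¹ ψ) = A.valuation (ζ - 1) := by
  classical
  have hωA : ∀ x, ω x ∈ A := fun x ↦ A.mem_of_isIntegral_int (ω.isIntegral_apply x)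
  have hω1 : ω⁻¹ ≠ 1 := by
    rw [Ne, inv_eq_one]
    rintro rfl
    have key : ∀ y : F, y = 0 ∨ y = 1 := by
      intro y
      by_cases hy : y = 0
      · exact .inl hy
      · right
        apply ι.injective
        rw [← hω y (hωA y), map_one]
        have : (⟨(1 : MulChar F ℂ) y, hωA y⟩ : A) = 1 := by
          ext
          simpa using MulChar.one_apply (R' := ℂ) (isUnit_iff_ne_zero.mpr hy)
        rw [this, map_one]
    obtain ⟨a, b, c, hab, hac, hbc⟩ := Fintype.two_lt_card_iff.mp hF
    rcases key a with rfl | rfl <;> rcases key b with rfl | rfl <;>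
      rcases key c with rfl | rfl <;> simp_all
  have hζA : ζ ∈ A := A.mem_of_isIntegral_int (.of_pow hp.out.pos (hζ ▸ isIntegral_one))
  set z : A := ⟨ζ, hζA⟩ with hz
  have hz1 : A.reduction z = 1 :=
    A.reduction_eq_one_of_pow_eq_one hp.out hA (k := 1) (by ext; simpa [hz] using hζ)
  set S : A := ∑ x : F, ⟨ω x⁻¹, hωA x⁻¹⟩ *
    ∑ i ∈ Finset.range (Algebra.trace (ZMod p) F x).val, z ^ i with hS
  have hgS : gaussSum ω⁻¹ ψ = (ζ - 1) * (S : ℂ) := by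
    have h0 := MulChar.sum_eq_zero_of_ne_one hω1
    calc gaussSum ω⁻¹ ψ = gaussSum ω⁻¹ ψ - ∑ x, ω⁻¹ x := by rw [h0, sub_zero]
      _ = ∑ x, ω x⁻¹ * (ψ x - 1) := by
        rw [gaussSum, ← Finset.sum_sub_distrib]
        refine Finset.sum_congr rfl fun x _ ↦ ?_
        rw [MulChar.inv_apply']; ring
      _ = _ := by
        rw [hS]
        push_cast
        rw [Finset.mul_sum]
        refine Finset.sum_congr rfl fun x _ ↦ ?_
        rw [hψ, ← mul_geom_sum]; ring
  have hSred : A.reduction S = -1 := by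
    have : A.reduction S = ι (∑ x : F, x⁻¹ *
        algebraMap (ZMod p) F (Algebra.trace (ZMod p) F x)) := by
      rw [hS, map_sum, map_sum]
      refine Finset.sum_congr rfl fun x _ ↦ ?_
      have h2 : algebraMap (ZMod p) F (Algebra.trace (ZMod p) F x) =
          ((Algebra.trace (ZMod p) F x).val : F) := by
        conv_lhs => rw [← ZMod.natCast_zmod_val (Algebra.trace (ZMod p) F x)]
        rw [map_natCast]
      rw [map_mul, map_mul, hω, map_sum, h2, map_natCast]
      simp [hz1]
    rw [this, FiniteField.sum_inv_mul_trace, map_neg, map_one]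
  have hvS : A.valuation (S : ℂ) = 1 := by
    refine le_antisymm (A.valuation_le_one S) (not_lt.mp fun h ↦ ?_)
    rw [← A.reduction_eq_zero_iff, hSred] at h
    simp at h
  rw [hgS, map_mul, hvS, mul_one]

/-- The valuation of `p` is at most that of `(ζ - 1) ^ (p - 1)`, where `ζ` is a primitive
`p`-th root of unity. -/
lemma ValuationSubring.valuation_prime_le {L : Type*} [Field L] (A : ValuationSubring L)
    {p : ℕ} (hp : p.Prime) {ζ : L} (hζ : IsPrimitiveRoot ζ p) :
    A.valuation (p : L) ≤ A.valuation (ζ - 1) ^ (p - 1) := by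
  have hζA : ζ ∈ A := A.mem_of_isIntegral_int (hζ.isIntegral hp.pos)
  obtain ⟨n, rfl⟩ : ∃ n, p = n + 1 := Nat.exists_eq_succ_of_ne_zero hp.ne_zero
  have h := hζ.prod_one_sub_pow_eq_order
  rw [← Nat.cast_succ] at h
  rw [← h, map_prod, Nat.add_sub_cancel, ← Finset.card_range n, ← Finset.prod_const]
  rw [Finset.card_range]
  refine Finset.prod_le_prod' fun i _ ↦ ?_
  rw [← mul_neg_geom_sum, map_mul, Valuation.map_sub_swap]
  refine mul_le_of_le_one_right' ?_
  rw [A.valuation_le_one_iff]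
  exact sum_mem fun j _ ↦ pow_mem hζA j

lemma FiniteField.trace_zmod_pow (p : ℕ) [hp : Fact p.Prime] {F : Type*} [Field F] [Fintype F]
    [Algebra (ZMod p) F] (x : F) :
    Algebra.trace (ZMod p) F (x ^ p) = Algebra.trace (ZMod p) F x := by
  have h := Algebra.trace_eq_of_algEquiv (FiniteField.frobeniusAlgEquivOfAlgebraic (ZMod p) F) x
  simpa using h

/-- Gauss sums with respect to Frobenius-invariant additive characters are invariant under
`χ ↦ χ ^ p`. -/
lemma gaussSum_pow_char (p : ℕ) [hp : Fact p.Prime] {F R : Type*} [Field F] [Fintype F]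
    [Algebra (ZMod p) F] [CommRing R] (χ : MulChar F R) (ψ : AddChar F R)
    (hψ : ∀ x, ψ (x ^ p) = ψ x) : gaussSum (χ ^ p) ψ = gaussSum χ ψ := by
  have := ZMod.charP p
  have : CharP F p := charP_of_injective_algebraMap (algebraMap (ZMod p) F).injective p
  rw [gaussSum, gaussSum]
  refine Function.Bijective.sum_comp (e := frobenius F p) ?_ (fun x ↦ χ x * ψ x) ▸ ?_
  · exact Finite.injective_iff_bijective.mp (frobenius F p).injective
  · refine Finset.sum_congr rfl fun x _ ↦ ?_
    rw [frobenius_def, hψ, map_pow, MulChar.pow_apply' _ hp.out.ne_zero]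

lemma Nat.sum_digits_eq_mod_add (p : ℕ) (hp : 1 < p) (n : ℕ) :
    (Nat.digits p n).sum = n % p + (Nat.digits p (n / p)).sum := by
  rcases Nat.eq_zero_or_pos n with rfl | hn
  · simp
  · rw [Nat.digits_def' hp hn, List.sum_cons]

lemma Nat.sum_digits_eq_sum_range {p : ℕ} (hp : 1 < p) (f : ℕ) :
    ∀ n < p ^ f, (Nat.digits p n).sum = ∑ i ∈ Finset.range f, n / p ^ i % p := by
  induction f with
  | zero => intro n hn; simp_all
  | succ f ih =>
    intro n hn
    rw [Nat.sum_digits_eq_mod_add p hp, ih (n / p) (Nat.div_lt_of_lt_mul (by rwa [← pow_succ'])),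
      Finset.sum_range_succ', add_comm]
    simp [Nat.div_div_eq_div_mul, pow_succ']

/-- The sum of the base `p` digits of `a * (p ^ f - 1) / N`. -/
lemma Nat.mul_sum_digits_eq {p f N a k : ℕ} (hp : 1 < p) (ha : a < N)
    (hk : k * N + a = a * p ^ f) :
    N * (Nat.digits p k).sum = (p - 1) * ∑ j ∈ Finset.range f, p ^ j * a % N := by
  have hN : 0 < N := by omega
  have hpf : 0 < p ^ f := Nat.pow_pos (by omega)
  have hkf : k < p ^ f := by
    by_contra! h
    have h1 : p ^ f * N ≤ k * N := Nat.mul_le_mul_right N h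
    have h2 : a * p ^ f ≤ N * p ^ f := Nat.mul_le_mul_right _ ha.le
    have h3 : p ^ f * N = N * p ^ f := mul_comm _ _
    have h4 : a = 0 := by omega
    subst h4
    have : k * N = 0 := by omega
    rcases Nat.mul_eq_zero.mp this with h | h <;> omega
  rw [Nat.sum_digits_eq_sum_range hp f k hkf]
  have hQ : ∀ i ≤ f, k / p ^ i = p ^ (f - i) * a / N := by
    intro i hi
    have h1 : p ^ f * a / N = k := by
      rw [mul_comm, ← hk, Nat.mul_comm k N, Nat.mul_add_div hN, Nat.div_eq_of_lt ha, add_zero]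
    rw [← h1, Nat.div_div_eq_div_mul, mul_comm N, ← Nat.div_div_eq_div_mul]
    congr 1
    rw [← Nat.sub_add_cancel hi, pow_add, Nat.add_sub_cancel, mul_right_comm]
    exact Nat.mul_div_cancel _ (Nat.pow_pos (by omega))
  zify
  rw [Nat.cast_sub hp.le, Nat.cast_one]
  have hd : ∀ i ∈ Finset.range f, (N : ℤ) * ((k / p ^ i % p : ℕ) : ℤ) =
      p * ((p ^ (f - (i + 1)) * a % N : ℕ) : ℤ) - ((p ^ (f - i) * a % N : ℕ) : ℤ) := by
    intro i hi
    rw [Finset.mem_range] at hi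
    have e1 := Nat.div_add_mod (k / p ^ i) p
    rw [Nat.div_div_eq_div_mul, ← pow_succ, hQ i hi.le, hQ (i + 1) hi] at e1
    have e2 := Nat.div_add_mod (p ^ (f - i) * a) N
    have e3 := Nat.div_add_mod (p ^ (f - (i + 1)) * a) N
    have e4 : p ^ (f - i) = p * p ^ (f - (i + 1)) := by
      rw [← pow_succ']; congr 1; omega
    rw [hQ i hi.le]
    zify at e1 e2 e3 e4 ⊢
    rw [e4] at e1 e2 ⊢
    linear_combination (N : ℤ) * e1 + e2 - (p : ℤ) * e3
  have hcast : ((∑ i ∈ Finset.range f, k / p ^ i % p : ℕ) : ℤ) =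
      ∑ i ∈ Finset.range f, ((k / p ^ i % p : ℕ) : ℤ) := by push_cast; rfl
  have key : (N : ℤ) * ∑ i ∈ Finset.range f, ((k / p ^ i % p : ℕ) : ℤ) =
      (p - 1) * ∑ j ∈ Finset.range f, ((p ^ j * a % N : ℕ) : ℤ) := by
    rw [Finset.mul_sum, Finset.sum_congr rfl hd, Finset.sum_sub_distrib, ← Finset.mul_sum]
    have s1 := Finset.sum_range_reflect (fun j ↦ ((p ^ j * a % N : ℕ) : ℤ)) f
    have s2 : ∑ i ∈ Finset.range f, ((p ^ (f - (i + 1)) * a % N : ℕ) : ℤ) =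
        ∑ j ∈ Finset.range f, ((p ^ j * a % N : ℕ) : ℤ) := by
      rw [← s1]
      refine Finset.sum_congr rfl fun i _ ↦ ?_
      rw [show f - (i + 1) = f - 1 - i by omega]
    have s3 : ∑ i ∈ Finset.range f, ((p ^ (f - i) * a % N : ℕ) : ℤ) =
        ∑ j ∈ Finset.range f, ((p ^ j * a % N : ℕ) : ℤ) := by
      have r1 := Finset.sum_range_succ (fun j ↦ ((p ^ j * a % N : ℕ) : ℤ)) f
      have r2 := Finset.sum_range_succ' (fun j ↦ ((p ^ j * a % N : ℕ) : ℤ)) f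
      have r3 := Finset.sum_range_reflect (fun j ↦ ((p ^ (j + 1) * a % N : ℕ) : ℤ)) f
      have r4 : p ^ f * a % N = p ^ 0 * a % N := by
        rw [mul_comm, ← hk, pow_zero, one_mul, add_comm, Nat.add_mul_mod_self_right]
      have r5 : ∑ i ∈ Finset.range f, ((p ^ (f - i) * a % N : ℕ) : ℤ) =
          ∑ j ∈ Finset.range f, ((p ^ (f - 1 - j + 1) * a % N : ℕ) : ℤ) := by
        refine Finset.sum_congr rfl fun i hi ↦ ?_
        rw [Finset.mem_range] at hi
        rw [show f - i = f - 1 - i + 1 by omega]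
      rw [r4] at r1
      rw [r5, r3]
      linarith
    rw [s2, s3]
    ring
  simpa using key

/-- A lower bound for the valuation of Gauss sums, one half of Stickelberger's theorem. Together
with the product formula for `gaussSum χ ψ * gaussSum χ⁻¹ ψ⁻¹` it determines the valuation. -/
lemma ValuationSubring.pow_sum_digits_le_valuation_gaussSum (A : ValuationSubring ℂ) {p : ℕ}
    [hp : Fact p.Prime] (hA : A.valuation (p : ℂ) < 1) {F : Type*} [Field F] [Fintype F]
    [Algebra (ZMod p) F] (hF : 2 < Fintype.card F)
    (ι : F →+* AlgebraicClosure (IsLocalRing.ResidueField A)) (ω : MulChar F ℂ)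
    (hω : ∀ x (hx : ω x ∈ A), A.reduction ⟨ω x, hx⟩ = ι x) {ζ : ℂ} (hζ : IsPrimitiveRoot ζ p)
    (ψ : AddChar F ℂ) (hψ : ∀ x, ψ x = ζ ^ (Algebra.trace (ZMod p) F x).val)
    (horder : orderOf ω⁻¹ = Fintype.card F - 1) (n : ℕ) (hn : n < Fintype.card F - 1) :
    A.valuation (ζ - 1) ^ (Nat.digits p n).sum ≤ A.valuation (gaussSum (ω⁻¹ ^ n) ψ) := by
  have hg1 := A.valuation_gaussSum_teichmuller_inv hA hF ι ω hω hζ.pow_eq_one ψ hψ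
  have hψp : ∀ x, ψ (x ^ p) = ψ x := fun x ↦ by
    rw [hψ, hψ, FiniteField.trace_zmod_pow]
  have hψ1 : ψ ≠ 1 := by
    obtain ⟨x, hx⟩ := Algebra.trace_surjective (ZMod p) F 1
    intro h
    have h2 := hψ x
    rw [hx, h, AddChar.one_apply, ZMod.val_one, pow_one] at h2
    exact hζ.ne_one hp.out.one_lt h2.symm
  have hstep : ∀ j, j + 1 < Fintype.card F - 1 → A.valuation (gaussSum (ω⁻¹ ^ j) ψ) *
      A.valuation (ζ - 1) ≤ A.valuation (gaussSum (ω⁻¹ ^ (j + 1)) ψ) := by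
    intro j hj
    have hne : ω⁻¹ ^ j * ω⁻¹ ≠ 1 := by
      rw [← pow_succ]
      exact pow_ne_one_of_lt_orderOf (by omega) (by omega)
    have hJ := jacobiSum_mul_nontrivial hne ψ
    rw [← hg1, ← map_mul, ← hJ, map_mul, pow_succ]
    exact mul_le_of_le_one_right' (A.valuation_le_one_of_isIntegral (isIntegral_jacobiSum _ _))
  have hsteps : ∀ d j, j + d < Fintype.card F - 1 → A.valuation (gaussSum (ω⁻¹ ^ j) ψ) *
      A.valuation (ζ - 1) ^ d ≤ A.valuation (gaussSum (ω⁻¹ ^ (j + d)) ψ) := by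
    intro d
    induction d with
    | zero => intro j _; simp
    | succ d ih =>
      intro j hj
      calc _ = A.valuation (gaussSum (ω⁻¹ ^ j) ψ) * A.valuation (ζ - 1) ^ d *
            A.valuation (ζ - 1) := by rw [pow_succ, mul_assoc]
        _ ≤ A.valuation (gaussSum (ω⁻¹ ^ (j + d)) ψ) * A.valuation (ζ - 1) :=
            mul_le_mul_left (ih j (by omega)) _
        _ ≤ _ := hstep (j + d) (by omega)
  induction n using Nat.strong_induction_on with
  | _ n ih =>
    rcases Nat.eq_zero_or_pos n with rfl | hpos
    · simp [gaussSum_one_left hψ1]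
    · have hlt : n / p < n := Nat.div_lt_self hpos hp.out.one_lt
      have h1 := ih (n / p) hlt (by omega)
      have hdm := Nat.div_add_mod n p
      have h2 := hsteps (n % p) (p * (n / p)) (by omega)
      rw [hdm, mul_comm p, pow_mul, gaussSum_pow_char p _ ψ hψp] at h2
      refine le_trans ?_ h2
      rw [Nat.sum_digits_eq_mod_add p hp.out.one_lt, add_comm, pow_add]
      exact mul_le_mul_left h1 _

/-- **Stickelberger's theorem** for a Gauss sum attached to a character of order `N`, as an
inequality for a character and its inverse. -/
theorem ValuationSubring.exists_stickelberger_le (A : ValuationSubring ℂ) {p : ℕ}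
    [hp : Fact p.Prime] (hA : A.valuation (p : ℂ) < 1) {F : Type*} [Field F] [Fintype F]
    [Algebra (ZMod p) F] {f N : ℕ} (hF : Fintype.card F = p ^ f) (χ : MulChar F ℂ)
    (hχ : orderOf χ = N) (hN : 1 < N) {ζ : ℂ} (hζ : IsPrimitiveRoot ζ p)
    (ψ : AddChar F ℂ) (hψ : ∀ x, ψ x = ζ ^ (Algebra.trace (ZMod p) F x).val) :
    ∃ a < N, Nat.Coprime a N ∧
      A.valuation (p : ℂ) ^ (∑ j ∈ Finset.range f, p ^ j * a % N) ≤
        A.valuation (gaussSum χ ψ) ^ N ∧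
      A.valuation (p : ℂ) ^ (∑ j ∈ Finset.range f, p ^ j * (N - a) % N) ≤
        A.valuation (gaussSum χ⁻¹ ψ) ^ N := by
  classical
  have hpow1 : ∀ φ : MulChar F ℂ, φ ^ (Fintype.card F - 1) = 1 := by
    intro φ
    ext x
    rw [MulChar.pow_apply_coe, ← map_pow, ← Units.val_pow_eq_pow_val]
    rw [← Fintype.card_units, pow_card_eq_one, MulChar.one_apply_coe, Units.val_one, map_one]
  have hq1 : 0 < Fintype.card F - 1 := by have := Fintype.one_lt_card (α := F); omega
  have hNdvd : N ∣ Fintype.card F - 1 := hχ ▸ orderOf_dvd_of_pow_eq_one (hpow1 χ)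
  obtain ⟨e, he⟩ := hNdvd
  have he0 : 0 < e := Nat.pos_of_ne_zero (by rintro rfl; omega)
  have hF2 : 2 < Fintype.card F := by
    have : N * 1 ≤ N * e := Nat.mul_le_mul_left N he0
    omega
  obtain ⟨ι, ω, hω⟩ := A.exists_teichmuller hA F
  have hωA : ∀ x, ω x ∈ A := fun x ↦ A.mem_of_isIntegral_int (ω.isIntegral_apply x)
  have horder : orderOf ω⁻¹ = Fintype.card F - 1 := by
    rw [orderOf_inv]
    refine Nat.dvd_antisymm (orderOf_dvd_of_pow_eq_one (hpow1 ω)) ?_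
    rw [← FiniteField.forall_pow_eq_one_iff]
    intro x
    have h1 : ω x ^ orderOf ω = 1 := by
      rw [← MulChar.pow_apply_coe, pow_orderOf_eq_one, MulChar.one_apply_coe]
    ext
    apply ι.injective
    have h2 : (⟨ω x, hωA x⟩ : A) ^ orderOf ω = 1 := by ext; simpa using h1
    rw [Units.val_pow_eq_pow_val, map_pow, ← hω x (hωA x), ← map_pow, h2]
    simp
  have hbound := A.pow_sum_digits_le_valuation_gaussSum hA hF2 ι ω hω hζ ψ hψ horder
  set φ := ω⁻¹ with hφ
  have hcard : Nat.card (MulChar F ℂ) = Fintype.card F - 1 := by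
    rw [MulChar.card_eq_card_units_of_hasEnoughRootsOfUnity, Nat.card_eq_fintype_card,
      Fintype.card_units]
  have : Finite (MulChar F ℂ) := Nat.finite_of_card_ne_zero (by omega)
  obtain ⟨k, hkq, hk⟩ : ∃ k < Fintype.card F - 1, φ ^ k = χ := by
    have hmem : χ ∈ Subgroup.zpowers φ := by
      have : Subgroup.zpowers φ = ⊤ := Subgroup.eq_top_of_card_eq _ (by
        rw [Nat.card_zpowers, horder, hcard])
      rw [this]; trivial
    rw [← mem_powers_iff_mem_zpowers] at hmem
    obtain ⟨k, hk⟩ := hmem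
    refine ⟨k % orderOf φ, horder ▸ Nat.mod_lt _ (horder ▸ hq1), ?_⟩
    rw [pow_mod_orderOf]; exact hk
  have hkN : Fintype.card F - 1 ∣ k * N := by
    rw [← horder]
    apply orderOf_dvd_of_pow_eq_one
    rw [pow_mul, hk, ← hχ, pow_orderOf_eq_one]
  have hek : e ∣ k := by
    rw [he, mul_comm k] at hkN
    exact Nat.dvd_of_mul_dvd_mul_left (by omega) hkN
  obtain ⟨a, rfl⟩ := hek
  have haN : a < N := by
    rw [he, mul_comm] at hkq
    exact Nat.lt_of_mul_lt_mul_right hkq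
  have hcop : Nat.Coprime a N := by
    set d := Nat.gcd a N with hd
    obtain ⟨a', ha'⟩ := Nat.gcd_dvd_left a N
    obtain ⟨N', hN'⟩ := Nat.gcd_dvd_right a N
    rw [← hd] at ha' hN'
    have h1 : χ ^ N' = 1 := by
      rw [← hk, ← pow_mul, ha', show e * (d * a') * N' = (d * N' * e) * a' by ring, ← hN', ← he,
        pow_mul, hpow1, one_pow]
    have h2 : N ∣ N' := hχ ▸ orderOf_dvd_of_pow_eq_one h1
    have hN'0 : 0 < N' := Nat.pos_of_ne_zero (by rintro rfl; omega)
    have h3 := Nat.le_of_dvd hN'0 h2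
    have hd0 : 0 < d := Nat.pos_of_ne_zero (by rintro h; rw [h] at hN'; omega)
    have h4 : d * N' ≤ 1 * N' := by omega
    exact Nat.le_antisymm (Nat.le_of_mul_le_mul_right h4 hN'0) hd0
  have ha0 : 0 < a := Nat.pos_of_ne_zero (by
    rintro rfl
    rw [Nat.coprime_zero_left] at hcop; omega)
  have hfinal : ∀ b, 0 < b → b < N → A.valuation (p : ℂ) ^ (∑ j ∈ Finset.range f, p ^ j * b % N) ≤
      A.valuation (gaussSum (φ ^ (e * b)) ψ) ^ N := by
    intro b hb0 hbN
    have hlt : e * b < Fintype.card F - 1 := by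
      rw [he, mul_comm N]; exact Nat.mul_lt_mul_of_pos_left hbN he0
    have hqf : p ^ f = N * e + 1 := by rw [← hF]; omega
    have hdig := Nat.mul_sum_digits_eq (p := p) (f := f) (k := e * b) hp.out.one_lt hbN
      (by rw [hqf]; ring)
    calc _ ≤ (A.valuation (ζ - 1) ^ (p - 1)) ^ (∑ j ∈ Finset.range f, p ^ j * b % N) :=
          pow_le_pow_left' (A.valuation_prime_le hp.out hζ) _
      _ = (A.valuation (ζ - 1) ^ (Nat.digits p (e * b)).sum) ^ N := by
          rw [← pow_mul, ← hdig, mul_comm, pow_mul]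
      _ ≤ _ := pow_le_pow_left' (hbound _ hlt) _
  refine ⟨a, haN, hcop, ?_, ?_⟩
  · rw [← hk]; exact hfinal a ha0 haN
  · have : χ⁻¹ = φ ^ (e * (N - a)) := by
      rw [inv_eq_iff_mul_eq_one, ← hk, ← pow_add, ← mul_add, Nat.add_sub_cancel' haN.le,
        mul_comm, ← he, hpow1]
    rw [this]; exact hfinal (N - a) (by omega) (by omega)

lemma Nat.mul_mod_add_mul_sub_mod {N b a : ℕ} (hN : 1 < N) (ha : a ≤ N) (h : (b * a).Coprime N) :
    b * a % N + b * (N - a) % N = N := by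
  obtain ⟨c, rfl⟩ := Nat.exists_eq_add_of_le ha
  rw [Nat.add_sub_cancel_left]
  have h1 : (b * a % (a + c) + b * c % (a + c)) % (a + c) = 0 := by
    rw [← Nat.add_mod, ← mul_add]; simp
  have h2 : b * a % (a + c) ≠ 0 := fun h0 => by
    have := Nat.dvd_gcd (Nat.dvd_of_mod_eq_zero h0) (dvd_refl _)
    rw [h] at this
    have := Nat.le_of_dvd one_pos this
    omega
  have h3 := Nat.mod_lt (b * a) (by omega : 0 < a + c)
  have h4 := Nat.mod_lt (b * c) (by omega : 0 < a + c)
  obtain ⟨k, hk⟩ := Nat.dvd_of_mod_eq_zero h1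
  have : k = 1 := by
    have : 0 < k := Nat.pos_of_ne_zero (by rintro rfl; omega)
    have : k < 2 := by
      by_contra! hk2
      have := Nat.mul_le_mul_left (a + c) hk2
      omega
    omega
  rw [hk, this, mul_one]

lemma AddChar.ne_one_of_eq_pow_trace {p : ℕ} [hp : Fact p.Prime] {F : Type*} [Field F] [Finite F]
    [Algebra (ZMod p) F] {R : Type*} [CommRing R] {ζ : R} (hζ : IsPrimitiveRoot ζ p)
    {ψ : AddChar F R} (hψ : ∀ x, ψ x = ζ ^ (Algebra.trace (ZMod p) F x).val) : ψ ≠ 1 := by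
  obtain ⟨x, hx⟩ := Algebra.trace_surjective (ZMod p) F 1
  intro h
  have h2 := hψ x
  rw [hx, h, AddChar.one_apply, ZMod.val_one, pow_one] at h2
  exact hζ.ne_one hp.out.one_lt h2.symm

/-- **Stickelberger's theorem** for a Gauss sum attached to a character of order `N`: the valuation
of the Gauss sum and of its complex conjugate. -/
theorem ValuationSubring.exists_stickelberger (A : ValuationSubring ℂ) {p : ℕ}
    [hp : Fact p.Prime] (hA : A.valuation (p : ℂ) < 1) {F : Type*} [Field F] [Fintype F]
    [Algebra (ZMod p) F] {f N : ℕ} (hF : Fintype.card F = p ^ f) (χ : MulChar F ℂ)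
    (hχ : orderOf χ = N) (hN : 1 < N) (hpN : p.Coprime N) {ζ : ℂ} (hζ : IsPrimitiveRoot ζ p)
    (ψ : AddChar F ℂ) (hψ : ∀ x, ψ x = ζ ^ (Algebra.trace (ZMod p) F x).val) :
    ∃ a < N, Nat.Coprime a N ∧
      A.valuation (gaussSum χ ψ) ^ N =
        A.valuation (p : ℂ) ^ (∑ j ∈ Finset.range f, p ^ j * a % N) ∧
      A.valuation (gaussSum χ⁻¹ ψ⁻¹) ^ N =
        A.valuation (p : ℂ) ^ (∑ j ∈ Finset.range f, p ^ j * (N - a) % N) := by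
  obtain ⟨a, haN, hcop, h1, h2⟩ := A.exists_stickelberger_le hA hF χ hχ hN hζ ψ hψ
  refine ⟨a, haN, hcop, ?_⟩
  have hχ1 : χ ≠ 1 := by rintro rfl; rw [orderOf_one] at hχ; omega
  have hψ1 : ψ ≠ 1 := AddChar.ne_one_of_eq_pow_trace hζ hψ
  have hsum : ∑ j ∈ Finset.range f, p ^ j * a % N + ∑ j ∈ Finset.range f, p ^ j * (N - a) % N =
      f * N := by
    rw [← Finset.sum_add_distrib, Finset.sum_congr rfl fun j _ =>
      Nat.mul_mod_add_mul_sub_mod hN haN.le ((hpN.pow_left j).mul_left hcop)]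
    simp
  have hinv : A.valuation (gaussSum χ⁻¹ ψ⁻¹) = A.valuation (gaussSum χ⁻¹ ψ) := by
    have hm : χ⁻¹ (-1) = 1 ∨ χ⁻¹ (-1) = -1 := by
      rw [← sq_eq_one_iff, ← map_pow]; simp
    rw [← mul_gaussSum_inv_eq_gaussSum χ⁻¹ ψ, map_mul]
    rcases hm with hm | hm <;> simp [hm]
  have hprod : A.valuation (gaussSum χ ψ) ^ N * A.valuation (gaussSum χ⁻¹ ψ⁻¹) ^ N =
      A.valuation (p : ℂ) ^ (f * N) := by
    rw [← mul_pow, ← map_mul, gaussSum_mul_gaussSum_eq_card hχ1 (AddChar.IsPrimitive.of_ne_one hψ1),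
      hF, Nat.cast_pow, map_pow, pow_mul]
  have hp0 : 0 < A.valuation (p : ℂ) := by
    rw [Valuation.pos_iff]; exact_mod_cast hp.out.ne_zero
  rw [← hinv] at h2
  rw [← hsum, pow_add] at hprod
  have hpos : ∀ n : ℕ, 0 < A.valuation (p : ℂ) ^ n := fun n ↦ pow_pos hp0 n
  constructor
  · refine le_antisymm (not_lt.mp fun h ↦ ?_) h1
    exact ((mul_lt_mul_of_pos_right h (hpos _)).trans_le (mul_le_mul_right h2 _)).ne hprod.symm
  · refine le_antisymm (not_lt.mp fun h ↦ ?_) h2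
    exact ((mul_lt_mul_of_pos_left h (hpos _)).trans_le (mul_le_mul_left h1 _)).ne hprod.symm

lemma Finset.sum_range_mul_eq {M : Type*} [AddCommMonoid M] (F : ℕ → M) (a b : ℕ) :
    ∑ r ∈ Finset.range (a * b), F r =
      ∑ s ∈ Finset.range b, ∑ r ∈ Finset.range a, F (a * s + r) := by
  induction b with
  | zero => simp
  | succ b ih => rw [mul_add_one, Finset.sum_range_add, ih, Finset.sum_range_succ]

lemma legendreSym_natCast_mod_prime_pow (ℓ : ℕ) [Fact ℓ.Prime] {m : ℕ} (hm : 1 ≤ m) (n : ℕ) :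
    legendreSym ℓ ((n % ℓ ^ m : ℕ) : ℤ) = legendreSym ℓ n := by
  rw [legendreSym, legendreSym]
  congr 1
  push_cast
  have : (ℓ : ℕ) ∣ ℓ ^ m := dvd_pow_self _ (by omega)
  have h := (Nat.mod_modEq n (ℓ ^ m)).of_dvd this
  exact_mod_cast (ZMod.natCast_eq_natCast_iff _ _ _).mpr h

lemma legendreSym_natCast_mul_add (ℓ : ℕ) [Fact ℓ.Prime] (s r : ℕ) :
    legendreSym ℓ ((ℓ * s + r : ℕ) : ℤ) = legendreSym ℓ r := by
  rw [legendreSym, legendreSym]; simp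

lemma legendreSym_neg_one_of_mod_four_eq_three {ℓ : ℕ} [Fact ℓ.Prime] (hℓ : ℓ % 4 = 3) :
    legendreSym ℓ (-1) = -1 := by
  rw [legendreSym.at_neg_one (by rintro rfl; omega)]
  exact ZMod.χ₄_nat_three_mod_four hℓ

/-- The residues on which the Legendre symbol takes a given nonzero value are half of the residues
prime to `ℓ`. -/
lemma two_mul_card_filter_legendreSym {ℓ : ℕ} [hℓ : Fact ℓ.Prime] (hℓ4 : ℓ % 4 = 3) {m : ℕ}
    (hm : 1 ≤ m) {ε : ℤ} (hε : ε = 1 ∨ ε = -1) :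
    2 * ((Finset.range (ℓ ^ m)).filter fun r : ℕ ↦ legendreSym ℓ r = ε).card =
      (ℓ ^ m).totient := by
  have hpos : 0 < ℓ ^ m := Nat.pow_pos hℓ.out.pos
  have hrefl : ((Finset.range (ℓ ^ m)).filter fun r : ℕ ↦ legendreSym ℓ r = ε).card =
      ((Finset.range (ℓ ^ m)).filter fun r : ℕ ↦ legendreSym ℓ r = -ε).card := by
    have key : ∀ ε : ℤ, (ε = 1 ∨ ε = -1) → ∀ r ∈ (Finset.range (ℓ ^ m)).filter
        (fun r : ℕ ↦ legendreSym ℓ r = ε), 0 < r ∧ r < ℓ ^ m ∧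
          legendreSym ℓ ((ℓ ^ m - r : ℕ) : ℤ) = -ε := by
      intro ε hε r hr
      rw [Finset.mem_filter, Finset.mem_range] at hr
      have hr0 : 0 < r := Nat.pos_of_ne_zero (by
        rintro rfl
        have := hr.2
        rw [Nat.cast_zero, legendreSym.at_zero] at this
        omega)
      refine ⟨hr0, hr.1, ?_⟩
      have hcast : (((ℓ ^ m - r : ℕ) : ℤ) : ZMod ℓ) = ((-1 * r : ℤ) : ZMod ℓ) := by
        rw [Nat.cast_sub hr.1.le]
        push_cast
        rw [ZMod.natCast_self, zero_pow (by omega)]; ring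
      have : legendreSym ℓ ((ℓ ^ m - r : ℕ) : ℤ) = legendreSym ℓ (-1 * r) := by
        rw [legendreSym, legendreSym, hcast]
      rw [this, legendreSym.mul, legendreSym_neg_one_of_mod_four_eq_three hℓ4, hr.2, neg_one_mul]
    refine Finset.card_bij' (fun r _ ↦ ℓ ^ m - r) (fun r _ ↦ ℓ ^ m - r) ?_ ?_ ?_ ?_
    · intro r hr
      have := key ε hε r hr
      simp only [Finset.mem_filter, Finset.mem_range]
      exact ⟨by omega, this.2.2⟩
    · intro r hr
      have := key (-ε) (by omega) r hr
      simp only [Finset.mem_filter, Finset.mem_range]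
      exact ⟨by omega, by rw [this.2.2, neg_neg]⟩
    · intro r hr
      have := key ε hε r hr
      omega
    · intro r hr
      have := key (-ε) (by omega) r hr
      omega
  have htot : (ℓ ^ m).totient =
      ((Finset.range (ℓ ^ m)).filter fun r : ℕ ↦ legendreSym ℓ r = ε).card +
      ((Finset.range (ℓ ^ m)).filter fun r : ℕ ↦ legendreSym ℓ r = -ε).card := by
    rw [Nat.totient_eq_card_coprime, ← Finset.card_union_of_disjoint]
    · congr 1
      ext r
      simp only [Finset.mem_filter, Finset.mem_range, Finset.mem_union]
      rw [← and_or_left]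
      refine and_congr_right fun _ ↦ ?_
      rw [Nat.coprime_pow_left_iff (by omega), hℓ.out.coprime_iff_not_dvd]
      have h0 := legendreSym.eq_zero_iff ℓ r
      rw [Int.cast_natCast, ZMod.natCast_eq_zero_iff] at h0
      rw [← h0]
      constructor
      · intro h
        rcases legendreSym.eq_one_or_neg_one ℓ (a := (r : ℤ))
          (by rwa [Ne, ← legendreSym.eq_zero_iff]) with h | h <;> omega
      · omega
    · rw [Finset.disjoint_filter]
      intro r _ h1 h2
      omega
  omega

/-- If `p` generates a subgroup of index two of the units modulo `ℓ ^ m`, then its cosets are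
the fibres of the Legendre symbol. -/
lemma sum_pow_mul_mod_eq_sum_filter_legendreSym {ℓ : ℕ} [hℓ : Fact ℓ.Prime] (hℓ4 : ℓ % 4 = 3)
    {m : ℕ} (hm : 1 ≤ m) {p f : ℕ} (hp : p.Coprime (ℓ ^ m)) (hf : f = orderOf (p : ZMod (ℓ ^ m)))
    (hf2 : 2 * f = (ℓ ^ m).totient) {a : ℕ} (ha : a.Coprime (ℓ ^ m)) {M : Type*} [AddCommMonoid M]
    (g : ℕ → M) :
    ∑ j ∈ Finset.range f, g (p ^ j * a % ℓ ^ m) =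
      ∑ r ∈ (Finset.range (ℓ ^ m)).filter (fun r : ℕ ↦ legendreSym ℓ r = legendreSym ℓ a), g r := by
  have hpos : 0 < ℓ ^ m := Nat.pow_pos hℓ.out.pos
  have hne : ∀ {b : ℕ}, b.Coprime (ℓ ^ m) → ((b : ℤ) : ZMod ℓ) ≠ 0 := by
    intro b hb
    rw [Int.cast_natCast, Ne, ZMod.natCast_eq_zero_iff, ← hℓ.out.coprime_iff_not_dvd,
      Nat.coprime_comm]
    exact (Nat.coprime_pow_right_iff (by omega) _ _).mp hb
  have hfodd : Odd f := by
    obtain ⟨k, rfl⟩ : ∃ k, m = k + 1 := ⟨m - 1, by omega⟩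
    rw [Nat.totient_prime_pow_succ hℓ.out] at hf2
    obtain ⟨c, hc⟩ : ∃ c, ℓ - 1 = 2 * (2 * c + 1) := ⟨ℓ / 4, by omega⟩
    rw [hc, mul_left_comm] at hf2
    have : f = ℓ ^ k * (2 * c + 1) := by omega
    rw [this]
    exact (Nat.odd_iff.mpr (by omega : ℓ % 2 = 1)).pow.mul ⟨c, rfl⟩
  have hlegp : legendreSym ℓ p = 1 := by
    have h1 : legendreSym ℓ p ^ f = 1 := by
      have h2 : (p : ZMod (ℓ ^ m)) ^ f = 1 := hf ▸ pow_orderOf_eq_one _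
      have h3 : p ^ f ≡ 1 [MOD ℓ ^ m] := by
        rw [← ZMod.natCast_eq_natCast_iff]; push_cast; exact h2
      have h4 : (p : ZMod ℓ) ^ f = 1 := by
        have := (ZMod.natCast_eq_natCast_iff _ _ _).mpr (h3.of_dvd (dvd_pow_self ℓ (by omega)))
        simpa using this
      rw [legendreSym, ← map_pow, Int.cast_natCast, h4, map_one]
    rcases legendreSym.eq_one_or_neg_one ℓ (hne hp) with h | h
    · exact h
    · rw [h, hfodd.neg_one_pow] at h1; omega
  have hmaps : ∀ j, legendreSym ℓ ((p ^ j * a % ℓ ^ m : ℕ) : ℤ) = legendreSym ℓ a := by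
    intro j
    rw [legendreSym_natCast_mod_prime_pow ℓ hm, Nat.cast_mul, legendreSym.mul]
    have : legendreSym ℓ ((p ^ j : ℕ) : ℤ) = 1 := by
      have : legendreSym ℓ ((p ^ j : ℕ) : ℤ) = legendreSym ℓ p ^ j := by
        rw [legendreSym, legendreSym]; push_cast; rw [map_pow]
      rw [this, hlegp, one_pow]
    rw [this, one_mul]
  have hinj : Set.InjOn (fun j ↦ p ^ j * a % ℓ ^ m) (Finset.range f : Set ℕ) := by
    intro i hi j hj hij
    simp only [Finset.coe_range, Set.mem_Iio] at hi hj
    have h1 : p ^ i * a ≡ p ^ j * a [MOD ℓ ^ m] := hij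
    have h2 := h1.cancel_right_of_coprime (by rw [Nat.gcd_comm]; exact ha)
    rw [← ZMod.natCast_eq_natCast_iff] at h2
    push_cast at h2
    have hu : IsUnit (p : ZMod (ℓ ^ m)) := (ZMod.isUnit_iff_coprime _ _).mpr hp
    exact pow_injOn_Iio_orderOf (by simpa [← hf] using hi) (by simpa [← hf] using hj) h2
  rw [← Finset.sum_image (f := g) (g := fun j ↦ p ^ j * a % ℓ ^ m) hinj]
  congr 1
  refine Finset.eq_of_subset_of_card_le ?_ ?_
  · intro r hr
    obtain ⟨j, _, rfl⟩ := Finset.mem_image.mp hr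
    rw [Finset.mem_filter, Finset.mem_range]
    exact ⟨Nat.mod_lt _ hpos, hmaps j⟩
  · rw [Finset.card_image_of_injOn hinj, Finset.card_range]
    have := two_mul_card_filter_legendreSym hℓ4 hm (legendreSym.eq_one_or_neg_one ℓ (hne ha))
    omega

lemma sum_filter_legendreSym_sub {ℓ : ℕ} [hℓ : Fact ℓ.Prime] (hℓ4 : ℓ % 4 = 3) {m : ℕ}
    (hm : 1 ≤ m) :
    ∑ r ∈ Finset.range (ℓ ^ m), legendreSym ℓ r * (r : ℤ) =
      (ℓ : ℤ) ^ (m - 1) * ∑ r ∈ Finset.range ℓ, legendreSym ℓ r * (r : ℤ) := by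
  obtain ⟨k, rfl⟩ : ∃ k, m = k + 1 := ⟨m - 1, by omega⟩
  have h0 : ∑ r ∈ Finset.range ℓ, legendreSym ℓ r = 0 := by
    have h1 := quadraticChar_sum_zero (F := ZMod ℓ)
      (by rw [ZMod.ringChar_zmod_n]; rintro rfl; omega)
    rw [← h1, Finset.sum_range]
    obtain ⟨l, rfl⟩ : ∃ l, ℓ = l + 1 := ⟨ℓ - 1, by omega⟩
    refine Finset.sum_congr rfl fun r _ ↦ ?_
    rw [legendreSym]
    congr 1
    rw [Int.cast_natCast]
    exact Fin.cast_val_eq_self r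
  rw [pow_succ', Finset.sum_range_mul_eq]
  simp_rw [legendreSym_natCast_mul_add]
  push_cast
  simp_rw [mul_add, Finset.sum_add_distrib, ← Finset.sum_mul, h0]
  simp

section

open Finset

theorem sum_filter_legendreSym_sub_neg {ℓ : ℕ} [Fact ℓ.Prime] (n : ℕ) (u : ℤ)
    (hu : u = 1 ∨ u = -1) :
    ∑ r ∈ (range n).filter (fun r : ℕ => legendreSym ℓ r = u), (r : ℤ) -
      ∑ r ∈ (range n).filter (fun r : ℕ => legendreSym ℓ r = -u), (r : ℤ) =
      u * ∑ r ∈ range n, legendreSym ℓ r * (r : ℤ) := by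
  rw [sum_filter, sum_filter, ← sum_sub_distrib, mul_sum]
  refine sum_congr rfl fun r _ => ?_
  rcases eq_or_ne ((r : ℤ) : ZMod ℓ) 0 with h | h
  · rw [(legendreSym.eq_zero_iff ℓ _).2 h]
    rcases hu with rfl | rfl <;> simp
  · rcases legendreSym.eq_one_or_neg_one ℓ h with h | h <;> rw [h] <;>
      rcases hu with rfl | rfl <;> simp

theorem ValuationSubring.valuation_gaussSum_index_two (A : ValuationSubring ℂ) {p : ℕ}
    [Fact p.Prime] (hA : A.valuation (p : ℂ) < 1) {F : Type*} [Field F] [Fintype F]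
    [Algebra (ZMod p) F] {ℓ : ℕ} [Fact ℓ.Prime] (hℓ4 : ℓ % 4 = 3) {m : ℕ} (hm : 1 ≤ m) {f : ℕ}
    (hF : Fintype.card F = p ^ f) (hpℓ : p.Coprime (ℓ ^ m))
    (hf : f = orderOf (p : ZMod (ℓ ^ m))) (hf2 : 2 * f = (ℓ ^ m).totient) {h : ℕ}
    (hh : |∑ r ∈ range ℓ, legendreSym ℓ r * (r : ℤ)| = ℓ * h)
    (χ : MulChar F ℂ) (hχ : orderOf χ = ℓ ^ m) {ζ : ℂ} (hζ : IsPrimitiveRoot ζ p)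
    (ψ : AddChar F ℂ) (hψ : ∀ x, ψ x = ζ ^ (Algebra.trace (ZMod p) F x).val) :
    ∃ k : ℕ, 2 * k + h = f ∧
      ((A.valuation (gaussSum χ ψ) = A.valuation (p : ℂ) ^ k ∧
          A.valuation (gaussSum χ⁻¹ ψ⁻¹) = A.valuation (p : ℂ) ^ (k + h)) ∨
        (A.valuation (gaussSum χ ψ) = A.valuation (p : ℂ) ^ (k + h) ∧
          A.valuation (gaussSum χ⁻¹ ψ⁻¹) = A.valuation (p : ℂ) ^ k)) := by
  have hN : 1 < ℓ ^ m := Nat.one_lt_pow (by omega) (Fact.out : ℓ.Prime).one_lt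
  obtain ⟨a, haN, hac, h1, h2⟩ := A.exists_stickelberger hA hF χ hχ hN hpℓ hζ ψ hψ
  have hNac : (ℓ ^ m - a).Coprime (ℓ ^ m) := by
    exact (Nat.coprime_self_sub_left haN.le).2 hac
  set N := ℓ ^ m with hNdef
  have hadd : ∑ j ∈ range f, p ^ j * a % N + ∑ j ∈ range f, p ^ j * (N - a) % N = f * N := by
    rw [← sum_add_distrib, sum_congr rfl fun j _ =>
      Nat.mul_mod_add_mul_sub_mod hN haN.le ((hpℓ.pow_left j).mul_left hac)]
    simp
  have hla : legendreSym ℓ a = 1 ∨ legendreSym ℓ a = -1 := by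
    apply legendreSym.eq_one_or_neg_one
    have : a.Coprime ℓ := hac.coprime_dvd_right (dvd_pow_self ℓ (by omega))
    intro h0
    rw [Int.cast_natCast, ZMod.natCast_eq_zero_iff] at h0
    have := Nat.dvd_gcd h0 dvd_rfl
    rw [Nat.Coprime] at *
    simp_all [(Fact.out : ℓ.Prime).ne_one]
  have hlNa : legendreSym ℓ ((N - a : ℕ)) = - legendreSym ℓ a := by
    have : (((N - a : ℕ) : ℤ)) = -1 * a + N := by push_cast [haN.le]; ring
    rw [this, legendreSym.mod, hNdef]
    have : ((-1 * (a : ℤ) + (ℓ ^ m : ℕ)) % ℓ) = (-1 * a) % ℓ := by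
      obtain ⟨c, hc⟩ : (ℓ : ℤ) ∣ (ℓ ^ m : ℕ) := by
        exact_mod_cast dvd_pow_self ℓ (by omega : m ≠ 0)
      rw [hc, Int.add_mul_emod_self_left]
    rw [this, ← legendreSym.mod, legendreSym.mul, legendreSym_neg_one_of_mod_four_eq_three hℓ4,
      neg_one_mul]
  have e1 := sum_pow_mul_mod_eq_sum_filter_legendreSym hℓ4 hm hpℓ hf hf2 hac (fun r => (r : ℤ))
  have e2 := sum_pow_mul_mod_eq_sum_filter_legendreSym hℓ4 hm hpℓ hf hf2 hNac (fun r => (r : ℤ))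
  have hdiff : |((∑ j ∈ range f, p ^ j * a % N : ℕ) : ℤ) -
      (∑ j ∈ range f, p ^ j * (N - a) % N : ℕ)| = N * h := by
    rw [Nat.cast_sum, Nat.cast_sum, e1, e2, hlNa, sum_filter_legendreSym_sub_neg _ _ hla,
      sum_filter_legendreSym_sub hℓ4 hm, abs_mul, abs_mul, hh]
    have : |legendreSym ℓ a| = 1 := by rcases hla with h | h <;> simp [h]
    rw [this, abs_of_nonneg (by positivity), one_mul, ← mul_assoc, ← pow_succ,
      Nat.sub_add_cancel hm, hNdef]
    push_cast; rfl
  generalize ∑ j ∈ range f, p ^ j * a % N = S at *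
  generalize ∑ j ∈ range f, p ^ j * (N - a) % N = S' at *
  have hodd : Odd N := (Nat.odd_iff.2 (by omega : ℓ % 2 = 1)).pow
  have hdvd : N ∣ S := by
    have : (N : ℤ) ∣ 2 * S := by
      have hadd' : (S : ℤ) + S' = f * N := by exact_mod_cast hadd
      rcases abs_choice ((S : ℤ) - S') with hc | hc <;> rw [hc] at hdiff
      · exact ⟨f + h, by linear_combination hadd' + hdiff⟩
      · exact ⟨f - h, by linear_combination hadd' - hdiff⟩
    have : N ∣ 2 * S := by exact_mod_cast this
    exact (Nat.Coprime.dvd_of_dvd_mul_left (Nat.coprime_two_right.2 hodd) this)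
  obtain ⟨k, rfl⟩ := hdvd
  have hdvd' : N ∣ S' := (Nat.dvd_add_right (dvd_mul_right N k)).1 (hadd ▸ dvd_mul_left N f)
  obtain ⟨k', rfl⟩ := hdvd'
  have hN0 : N ≠ 0 := by omega
  have hkk : k + k' = f := by
    apply Nat.eq_of_mul_eq_mul_left (by omega : 0 < N); rw [mul_add, hadd, mul_comm]
  have hkd : |(k : ℤ) - k'| = h := by
    have : (N : ℤ) ≠ 0 := by exact_mod_cast hN0
    apply mul_left_cancel₀ this
    rw [← hdiff]
    push_cast
    rw [← mul_sub, abs_mul, Nat.abs_cast]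
  rw [mul_comm, pow_mul] at h1 h2
  rw [pow_left_inj₀ zero_le zero_le hN0] at h1 h2
  rcases abs_choice ((k : ℤ) - k') with hc | hc <;> rw [hc] at hkd
  · refine ⟨k', by omega, Or.inr ⟨?_, h2⟩⟩
    rw [h1]; congr 1; omega
  · refine ⟨k, by omega, Or.inl ⟨h1, ?_⟩⟩
    rw [h2]; congr 1; omega

end

section

open Finset


theorem ZMod.sum_range_natCast {M : Type*} [AddCommMonoid M] (n : ℕ) [NeZero n] (F : ZMod n → M) :
    ∑ r ∈ range n, F r = ∑ x, F x := by
  refine sum_nbij' (fun r => (r : ZMod n)) ZMod.val (by simp) ?_ ?_ (by simp) (by simp)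
  · intro x _; simpa using ZMod.val_lt x
  · intro r hr; exact ZMod.val_cast_of_lt (by simpa using hr)

theorem not_dvd_pred_of_two_mul_orderOf {ℓ m p : ℕ} (hℓ : ℓ.Prime) (hℓ3 : 3 < ℓ) (hm : 1 ≤ m)
    (hp : 1 ≤ p)
    (h : 2 * orderOf (p : ZMod (ℓ ^ m)) = (ℓ ^ m).totient) : ¬ ℓ ∣ p - 1 := by
  intro hd
  obtain ⟨k, rfl⟩ := Nat.exists_eq_add_of_le' hm
  have h1 : ((ℓ : ℕ) : ℤ) ∣ (p : ℤ) - 1 := by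
    have : ((p - 1 : ℕ) : ℤ) = p - 1 := by push_cast [hp]; ring
    rw [← this]; exact_mod_cast hd
  have h2 := dvd_sub_pow_of_dvd_sub h1 k
  have h3 : (p : ZMod (ℓ ^ (k + 1))) ^ ℓ ^ k = 1 := by
    have := (ZMod.intCast_zmod_eq_zero_iff_dvd _ (ℓ ^ (k + 1))).2 (by exact_mod_cast h2)
    push_cast at this
    simpa [sub_eq_zero] using this
  have h4 := Nat.le_of_dvd (pow_pos hℓ.pos k) (orderOf_dvd_of_pow_eq_one h3)
  rw [Nat.totient_prime_pow_succ hℓ] at h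
  have : ℓ ^ k * (ℓ - 1) ≤ ℓ ^ k * 2 := by omega
  have := Nat.le_of_mul_le_mul_left this (pow_pos hℓ.pos k)
  omega

theorem Submodule.intCast_mem_span_one (v : Set ℂ) (n : ℤ) :
    (n : ℂ) ∈ Submodule.span ℚ (insert 1 v) := by
  have : (n : ℂ) = (n : ℚ) • (1 : ℂ) := by simp [Rat.smul_def]
  rw [this]
  exact Submodule.smul_mem _ _ (Submodule.subset_span (Set.mem_insert _ _))

theorem legendreSym.sq_sum_mul_pow {ℓ : ℕ} [Fact ℓ.Prime] (hℓ4 : ℓ % 4 = 3) {z : ℂ}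
    (hz : IsPrimitiveRoot z ℓ) :
    (∑ r ∈ range ℓ, (legendreSym ℓ r : ℂ) * z ^ r) ^ 2 = -ℓ := by
  have hψ := AddChar.zmodChar_primitive_of_primitive_root ℓ hz
  set ψ := AddChar.zmodChar ℓ hz.pow_eq_one with hψdef
  have hχ : quadraticChar (ZMod ℓ) ≠ 1 := by
    apply quadraticChar_ne_one
    rw [ZMod.ringChar_zmod_n]; omega
  have hχ' : (quadraticChar (ZMod ℓ)).ringHomComp (Int.castRingHom ℂ) ≠ 1 := by
    rw [Ne, MulChar.ringHomComp_eq_one_iff Int.cast_injective]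
    exact hχ
  have h1 := gaussSum_sq hχ' ((quadraticChar_isQuadratic _).comp _) hψ
  have h2 : gaussSum ((quadraticChar (ZMod ℓ)).ringHomComp (Int.castRingHom ℂ)) ψ =
      ∑ r ∈ range ℓ, (legendreSym ℓ r : ℂ) * z ^ r := by
    rw [gaussSum, ← ZMod.sum_range_natCast]
    refine sum_congr rfl fun r hr => ?_
    rw [hψdef, AddChar.zmodChar_apply, ZMod.val_cast_of_lt (by simpa using hr)]
    simp [legendreSym]
  rw [← h2, h1]
  have := legendreSym_neg_one_of_mod_four_eq_three hℓ4
  rw [legendreSym] at this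
  push_cast at this
  simp [this]

theorem sum_legendreSym_mul_pow_mem {ℓ : ℕ} [Fact ℓ.Prime] (hℓ4 : ℓ % 4 = 3) {z : ℂ}
    (hz : z ^ ℓ = 1) : ∑ r ∈ range ℓ, (legendreSym ℓ r : ℂ) * z ^ r ∈
      Submodule.span ℚ {1, Complex.I * (√ℓ : ℂ)} := by
  rcases eq_or_ne z 1 with rfl | hz1
  · simp_rw [one_pow, mul_one]
    exact_mod_cast Submodule.intCast_mem_span_one _ _
  have hp : IsPrimitiveRoot z ℓ := IsPrimitiveRoot.iff_orderOf.2 (orderOf_eq_prime hz hz1)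
  have h1 := legendreSym.sq_sum_mul_pow hℓ4 hp
  have h2 : (Complex.I * (√ℓ : ℂ)) ^ 2 = -ℓ := by
    rw [mul_pow, Complex.I_sq, ← Complex.ofReal_pow, Real.sq_sqrt (Nat.cast_nonneg _)]
    simp
  have h3 : Complex.I * (√ℓ : ℂ) ∈ Submodule.span ℚ {1, Complex.I * (√ℓ : ℂ)} :=
    Submodule.subset_span (by simp)
  rcases sq_eq_sq_iff_eq_or_eq_neg.1 (h1.trans h2.symm) with h | h <;> rw [h]
  · exact h3
  · exact Submodule.neg_mem _ h3

theorem sum_legendreSym_sq_mul_pow {ℓ : ℕ} [Fact ℓ.Prime] {z : ℂ} (hz : z ^ ℓ = 1) :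
    ∃ n : ℤ, ∑ r ∈ range ℓ, (legendreSym ℓ r : ℂ) ^ 2 * z ^ r = n := by
  rcases eq_or_ne z 1 with rfl | hz1
  · exact ⟨∑ r ∈ range ℓ, legendreSym ℓ r ^ 2, by simp⟩
  have hp : IsPrimitiveRoot z ℓ := IsPrimitiveRoot.iff_orderOf.2 (orderOf_eq_prime hz hz1)
  have h1 := hp.geom_sum_eq_zero (Fact.out : ℓ.Prime).one_lt
  obtain ⟨k, rfl⟩ : ∃ k, ℓ = k + 1 := ⟨ℓ - 1, by have := (Fact.out : ℓ.Prime).pos; omega⟩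
  refine ⟨-1, ?_⟩
  rw [sum_range_succ'] at h1 ⊢
  have : ∀ r ∈ range k, (legendreSym (k + 1) ((r + 1 : ℕ) : ℤ) : ℂ) ^ 2 * z ^ (r + 1)
      = z ^ (r + 1) := by
    intro r hr
    rw [← Int.cast_pow, legendreSym.sq_one]
    · simp
    · rw [Int.cast_natCast, Ne, ZMod.natCast_eq_zero_iff]
      exact Nat.not_dvd_of_pos_of_lt (by omega) (by simpa using hr)
  rw [sum_congr rfl this]
  push_cast
  rw [legendreSym.at_zero]
  linear_combination h1

theorem sum_range_filter_legendreSym_pow_mem {ℓ : ℕ} [Fact ℓ.Prime] (hℓ4 : ℓ % 4 = 3) {m : ℕ}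
    (hm : 1 ≤ m) {z : ℂ} (hz : z ^ ℓ ^ m = 1) :
    ∑ r ∈ (range (ℓ ^ m)).filter (fun r : ℕ => legendreSym ℓ r = 1), z ^ r ∈
      Submodule.span ℚ {1, Complex.I * (√ℓ : ℂ)} := by
  have h1 : ∑ r ∈ (range (ℓ ^ m)).filter (fun r : ℕ => legendreSym ℓ r = 1), z ^ r =
      (1 / 2 : ℚ) • ∑ r ∈ range (ℓ ^ m),
        ((legendreSym ℓ r : ℂ) ^ 2 + (legendreSym ℓ r : ℂ)) * z ^ r := by
    rw [Rat.smul_def, mul_sum, sum_filter]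
    refine sum_congr rfl fun r _ => ?_
    rcases eq_or_ne ((r : ℤ) : ZMod ℓ) 0 with h | h
    · rw [(legendreSym.eq_zero_iff ℓ _).2 h]; simp
    · rcases legendreSym.eq_one_or_neg_one ℓ h with h | h <;> rw [h]
      · simp; ring
      · simp
  rw [h1]
  apply Submodule.smul_mem
  obtain ⟨k, rfl⟩ := Nat.exists_eq_add_of_le' hm
  rw [pow_succ', sum_range_mul_eq]
  have h2 : ∀ s ∈ range (ℓ ^ k), ∑ r ∈ range ℓ, ((legendreSym ℓ ((ℓ * s + r : ℕ) : ℤ) : ℂ) ^ 2 +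
      (legendreSym ℓ ((ℓ * s + r : ℕ) : ℤ) : ℂ)) * z ^ (ℓ * s + r) =
      (z ^ ℓ) ^ s * ∑ r ∈ range ℓ, ((legendreSym ℓ r : ℂ) ^ 2 + (legendreSym ℓ r : ℂ)) * z ^ r := by
    intro s _
    rw [mul_sum]
    refine sum_congr rfl fun r _ => ?_
    rw [legendreSym_natCast_mul_add, pow_add, pow_mul]; ring
  rw [sum_congr rfl h2, ← sum_mul]
  rcases eq_or_ne (z ^ ℓ) 1 with h | h
  · rw [h]
    simp only [one_pow, sum_const, card_range, nsmul_eq_mul, mul_one, add_mul, sum_add_distrib]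
    have : (((ℓ ^ k : ℕ) : ℕ) : ℂ) * (∑ r ∈ range ℓ, (legendreSym ℓ r : ℂ) ^ 2 * z ^ r +
        ∑ r ∈ range ℓ, (legendreSym ℓ r : ℂ) * z ^ r) =
        ((ℓ ^ k : ℕ) : ℚ) • (∑ r ∈ range ℓ, (legendreSym ℓ r : ℂ) ^ 2 * z ^ r +
        ∑ r ∈ range ℓ, (legendreSym ℓ r : ℂ) * z ^ r) := by
      rw [Rat.smul_def]; push_cast; rfl
    rw [this]
    obtain ⟨n, hn⟩ := sum_legendreSym_sq_mul_pow h
    refine Submodule.smul_mem _ _ (Submodule.add_mem _ ?_ (sum_legendreSym_mul_pow_mem hℓ4 h))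
    rw [hn]
    exact Submodule.intCast_mem_span_one _ _
  · have := mul_neg_geom_sum (z ^ ℓ) (ℓ ^ k)
    rw [← pow_mul, ← pow_succ', hz, sub_self] at this
    rcases mul_eq_zero.1 this with h' | h'
    · exact absurd (sub_eq_zero.1 h').symm h
    · rw [h']; simp

end

section

open Finset

theorem MulChar.apply_algebraMap_eq_one {p : ℕ} [Fact p.Prime] {F : Type*} [Field F]
    [Algebra (ZMod p) F] {N : ℕ} (hN : N.Coprime (p - 1)) {R : Type*} [CommRing R]
    (χ : MulChar F R) (hχ : χ ^ N = 1) {c : ZMod p} (hc : c ≠ 0) :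
    χ (algebraMap (ZMod p) F c) = 1 := by
  have hc' : IsUnit (algebraMap (ZMod p) F c) := by simpa using hc
  obtain ⟨u, hu⟩ := hc'
  have h1 : χ u ^ N = 1 := by
    rw [← MulChar.pow_apply_coe, hχ, MulChar.one_apply_coe]
  have h2 : χ u ^ (p - 1) = 1 := by
    rw [← map_pow, hu, ← map_pow, ZMod.pow_card_sub_one_eq_one hc]; simp
  have := pow_gcd_eq_one.2 ⟨h1, h2⟩
  rwa [hN, pow_one, hu] at this

theorem pred_mul_gaussSum_eq {p : ℕ} [Fact p.Prime] {F : Type*} [Field F] [Fintype F]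
    [Algebra (ZMod p) F] (χ : MulChar F ℂ) (hχ1 : χ ≠ 1)
    (hχ : ∀ c : ZMod p, c ≠ 0 → χ (algebraMap (ZMod p) F c) = 1) {ζ : ℂ}
    (hζ : IsPrimitiveRoot ζ p) (ψ : AddChar F ℂ)
    (hψ : ∀ x, ψ x = ζ ^ (Algebra.trace (ZMod p) F x).val) :
    ((p : ℂ) - 1) * gaussSum χ ψ =
      ∑ a, ((if Algebra.trace (ZMod p) F a = 0 then p else 0 : ℕ) : ℂ) * χ a := by
  classical
  have hφ := AddChar.zmodChar_primitive_of_primitive_root p hζ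
  set φ := AddChar.zmodChar p hζ.pow_eq_one with hφdef
  have hψφ : ∀ x, ψ x = φ (Algebra.trace (ZMod p) F x) := fun x => by
    rw [hψ, hφdef, AddChar.zmodChar_apply]
  have h1 : ∑ c : ZMod p, ∑ a : F, χ a * ψ (algebraMap (ZMod p) F c * a) =
      ∑ a, ((if Algebra.trace (ZMod p) F a = 0 then p else 0 : ℕ) : ℂ) * χ a := by
    rw [sum_comm]
    refine sum_congr rfl fun a _ => ?_
    rw [← mul_sum, mul_comm]
    congr 1
    have := AddChar.sum_mulShift (Algebra.trace (ZMod p) F a) hφ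
    rw [ZMod.card] at this
    rw [← this]
    refine sum_congr rfl fun c _ => ?_
    rw [hψφ, ← Algebra.smul_def, map_smul, smul_eq_mul]
  rw [← h1, ← add_sum_erase _ _ (mem_univ (0 : ZMod p))]
  have h0 : ∑ a : F, χ a * ψ (algebraMap (ZMod p) F 0 * a) = 0 := by
    simp [MulChar.sum_eq_zero_of_ne_one hχ1]
  have h2 : ∀ c ∈ univ.erase (0 : ZMod p), ∑ a : F, χ a * ψ (algebraMap (ZMod p) F c * a) =
      gaussSum χ ψ := by
    intro c hc
    have hc : c ≠ 0 := by simpa using hc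
    have hc' : IsUnit (algebraMap (ZMod p) F c) := by simpa using hc
    obtain ⟨u, hu⟩ := hc'
    have := gaussSum_mulShift χ ψ u
    rw [hu, hχ c hc, one_mul] at this
    rw [← this, gaussSum]
    simp [AddChar.mulShift_apply]
  rw [h0, zero_add, sum_congr rfl h2, sum_const, card_erase_of_mem (mem_univ _), card_univ,
    ZMod.card, nsmul_eq_mul, Nat.cast_sub (Fact.out : p.Prime).one_le]
  simp

theorem gaussSum_mem_span_index_two {p : ℕ} [Fact p.Prime] {F : Type*} [Field F] [Fintype F]
    [Algebra (ZMod p) F] {ℓ : ℕ} [Fact ℓ.Prime] (hℓ4 : ℓ % 4 = 3) (hℓ3 : 3 < ℓ) {m : ℕ}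
    (hm : 1 ≤ m) {f : ℕ} (hpℓ : p.Coprime (ℓ ^ m))
    (hf : f = orderOf (p : ZMod (ℓ ^ m))) (hf2 : 2 * f = (ℓ ^ m).totient)
    (χ : MulChar F ℂ) (hχ : orderOf χ = ℓ ^ m) {ζ : ℂ} (hζ : IsPrimitiveRoot ζ p)
    (ψ : AddChar F ℂ) (hψ : ∀ x, ψ x = ζ ^ (Algebra.trace (ZMod p) F x).val) :
    gaussSum χ ψ ∈ Submodule.span ℚ {1, Complex.I * (√ℓ : ℂ)} := by
  have hp := (Fact.out : p.Prime)
  have hℓ := (Fact.out : ℓ.Prime)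
  have hN1 : 1 < ℓ ^ m := Nat.one_lt_pow (by omega) hℓ.one_lt
  have hχN : χ ^ ℓ ^ m = 1 := hχ ▸ pow_orderOf_eq_one χ
  have hcop : (ℓ ^ m).Coprime (p - 1) := Nat.Coprime.pow_left _
    ((Nat.Prime.coprime_iff_not_dvd hℓ).2
      (not_dvd_pred_of_two_mul_orderOf hℓ hℓ3 hm hp.one_le (hf ▸ hf2)))
  have hψp : ∀ x, ψ (x ^ p) = ψ x := fun x => by rw [hψ, hψ, FiniteField.trace_zmod_pow]
  have hiter : ∀ i, gaussSum (χ ^ p ^ i) ψ = gaussSum χ ψ := by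
    intro i
    induction i with
    | zero => simp
    | succ i ih => rw [pow_succ, pow_mul, gaussSum_pow_char p _ ψ hψp, ih]
  have hne : ∀ i, χ ^ p ^ i ≠ 1 := by
    intro i h1
    have h2 := orderOf_dvd_of_pow_eq_one h1
    rw [hχ] at h2
    have := Nat.Coprime.eq_one_of_dvd ((hpℓ.pow_left i).symm) h2
    omega
  have key : ∀ i, ((p : ℂ) - 1) * gaussSum χ ψ =
      ∑ a, ((if Algebra.trace (ZMod p) F a = 0 then p else 0 : ℕ) : ℂ) * χ a ^ p ^ i := by
    intro i
    rw [← hiter i, pred_mul_gaussSum_eq (χ ^ p ^ i) (hne i) _ hζ ψ hψ]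
    · refine sum_congr rfl fun a _ => ?_
      rw [MulChar.pow_apply' _ (pow_ne_zero _ hp.ne_zero)]
    · intro c hc
      apply MulChar.apply_algebraMap_eq_one hcop _ _ hc
      rw [← pow_mul, mul_comm, pow_mul, hχN, one_pow]
  have hsum : (f : ℂ) * (((p : ℂ) - 1) * gaussSum χ ψ) = ∑ a,
      ((if Algebra.trace (ZMod p) F a = 0 then p else 0 : ℕ) : ℚ) •
        ∑ i ∈ range f, χ a ^ p ^ i := by
    have : (f : ℂ) * (((p : ℂ) - 1) * gaussSum χ ψ) =
      ∑ i ∈ range f, ((p : ℂ) - 1) * gaussSum χ ψ := by simp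
    rw [this, sum_congr rfl fun i _ => key i, sum_comm]
    refine sum_congr rfl fun a _ => ?_
    rw [Rat.smul_def, mul_sum, Rat.cast_natCast]
  have hmem : (f : ℂ) * (((p : ℂ) - 1) * gaussSum χ ψ) ∈
      Submodule.span ℚ {1, Complex.I * (√ℓ : ℂ)} := by
    rw [hsum]
    refine Submodule.sum_mem _ fun a _ => Submodule.smul_mem _ _ ?_
    rcases eq_or_ne a 0 with rfl | ha
    · simp_rw [MulChar.map_zero, zero_pow (pow_ne_zero _ hp.ne_zero), sum_const_zero]
      exact zero_mem _
    have hz : χ a ^ ℓ ^ m = 1 := by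
      rw [← MulChar.pow_apply' _ (by omega), hχN, MulChar.one_apply (by simpa using ha)]
    have h1 := sum_pow_mul_mod_eq_sum_filter_legendreSym hℓ4 hm hpℓ hf hf2 (a := 1) (by simp)
      (fun r => χ a ^ r)
    have h2 : ∀ i ∈ range f, χ a ^ (p ^ i * 1 % ℓ ^ m) = χ a ^ p ^ i := by
      intro i _
      rw [mul_one, ← pow_eq_pow_mod _ hz]
    rw [sum_congr rfl h2] at h1
    rw [h1]
    have : legendreSym ℓ ((1 : ℕ) : ℤ) = 1 := by simp
    rw [this]
    exact sum_range_filter_legendreSym_pow_mem hℓ4 hm hz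
  have hf0 : (f : ℚ) ≠ 0 := by
    have : 0 < (ℓ ^ m).totient := Nat.totient_pos.2 (by omega)
    have : f ≠ 0 := by omega
    exact_mod_cast this
  have hp0 : (p : ℚ) - 1 ≠ 0 := by
    have := hp.one_lt
    have : (1 : ℚ) < p := by exact_mod_cast this
    linarith
  have : gaussSum χ ψ =
      ((f : ℚ) * ((p : ℚ) - 1))⁻¹ • ((f : ℂ) * (((p : ℂ) - 1) * gaussSum χ ψ)) := by
    rw [eq_inv_smul_iff₀ (mul_ne_zero hf0 hp0), Rat.smul_def]
    push_cast; ring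
  rw [this]
  exact Submodule.smul_mem _ _ hmem

end

section

open Finset

theorem ValuationSubring.valuation_gaussSum_add_one_lt (A : ValuationSubring ℂ) {ℓ : ℕ}
    (hℓ : ℓ.Prime) (hA : A.valuation (ℓ : ℂ) < 1) {F : Type*} [Field F] [Fintype F] {m : ℕ}
    {χ : MulChar F ℂ} (hχ : χ ^ ℓ ^ m = 1) {ψ : AddChar F ℂ} (hψ : ψ ≠ 1) :
    A.valuation (gaussSum χ ψ + 1) < 1 := by
  classical
  have h0 := AddChar.sum_eq_zero_of_ne_one hψ
  have h1 : gaussSum χ ψ + 1 = ∑ x, (χ x - if x = 0 then 0 else 1) * ψ x := by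
    simp_rw [sub_mul, sum_sub_distrib, ite_mul, zero_mul, one_mul]
    have : ∑ x, (if x = 0 then 0 else ψ x) = ∑ x, ψ x - 1 := by
      rw [← add_sum_erase _ _ (mem_univ (0 : F)), ← add_sum_erase _ ψ (mem_univ (0 : F)),
        AddChar.map_zero_eq_one, if_pos rfl]
      rw [sum_congr rfl fun x hx => if_neg (by simpa using hx)]
      ring
    rw [this, h0, gaussSum]; ring
  rw [h1]
  refine Valuation.map_sum_lt _ one_ne_zero fun x _ => ?_
  rw [map_mul]
  refine mul_lt_one_of_lt_of_le ?_ (A.valuation_le_one_of_isIntegral (ψ.isIntegral_apply x))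
  split_ifs with hx
  · simp [hx, MulChar.map_zero]
  · have hz : χ x ^ ℓ ^ m = 1 := by
      rw [← MulChar.pow_apply' _ (pow_ne_zero _ hℓ.ne_zero), hχ,
        MulChar.one_apply (by simpa using hx)]
    have hxA : χ x ∈ A := A.mem_of_isIntegral_int (χ.isIntegral_apply x)
    have := A.reduction_eq_one_of_pow_eq_one hℓ hA (z := ⟨χ x, hxA⟩) (by ext; simpa using hz)
    have h2 := (A.reduction_eq_zero_iff (⟨χ x, hxA⟩ - 1)).1
      (by rw [map_sub, this, map_one, sub_self])
    simpa using h2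

theorem Rat.exists_intCast_eq_of_isIntegral {L : Type*} [Field L] [CharZero L] {r : ℚ}
    (h : IsIntegral ℤ (r : L)) : ∃ n : ℤ, (n : ℚ) = r := by
  have h1 : IsIntegral ℤ (algebraMap ℚ L r) := by simpa using h
  rw [isIntegral_algebraMap_iff (algebraMap ℚ L).injective] at h1
  obtain ⟨n, hn⟩ := IsIntegrallyClosed.isIntegral_iff.1 h1
  exact ⟨n, by simpa using hn⟩

theorem Rat.exists_intCast_eq_of_prime_mul_sq {ℓ : ℕ} (hℓ : ℓ.Prime) {r : ℚ} {n : ℤ}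
    (h : ℓ * r ^ 2 = n) : ∃ k : ℤ, (k : ℚ) = r := by
  have h1 : IsIntegral ℤ ((ℓ * r : ℚ)) := by
    refine IsIntegral.of_pow two_pos ?_
    have : (ℓ * r) ^ 2 = ((ℓ * n : ℤ) : ℚ) := by push_cast; rw [← h]; ring
    rw [this]; exact isIntegral_algebraMap (R := ℤ) (x := (ℓ * n : ℤ))
  obtain ⟨t, ht⟩ := Rat.exists_intCast_eq_of_isIntegral (L := ℚ) (r := ℓ * r) (by simpa using h1)
  have hℓ0 : (ℓ : ℚ) ≠ 0 := by exact_mod_cast hℓ.ne_zero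
  have h2 : t ^ 2 = ℓ * n := by
    have : (t : ℚ) ^ 2 = ℓ * n := by rw [ht, ← h]; ring
    exact_mod_cast this
  obtain ⟨k, rfl⟩ := (Nat.prime_iff_prime_int.1 hℓ).dvd_of_dvd_pow (h2 ▸ dvd_mul_right (ℓ : ℤ) n)
  refine ⟨k, mul_left_cancel₀ hℓ0 ?_⟩
  rw [← ht]; push_cast; rfl

theorem exists_gaussSum_eq_index_two {p : ℕ} [Fact p.Prime] {F : Type*} [Field F] [Fintype F]
    [Algebra (ZMod p) F] {ℓ : ℕ} [Fact ℓ.Prime] (hℓ4 : ℓ % 4 = 3) (hℓ3 : 3 < ℓ) {m : ℕ}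
    (hm : 1 ≤ m) {f : ℕ} (hF : Fintype.card F = p ^ f) (hpℓ : p.Coprime (ℓ ^ m))
    (hf : f = orderOf (p : ZMod (ℓ ^ m))) (hf2 : 2 * f = (ℓ ^ m).totient)
    {h : ℕ} (hh0 : 0 < h)
    (hh : |∑ r ∈ range ℓ, legendreSym ℓ r * (r : ℤ)| = ℓ * h)
    (χ : MulChar F ℂ) (hχ : orderOf χ = ℓ ^ m) {ζ : ℂ} (hζ : IsPrimitiveRoot ζ p)
    (ψ : AddChar F ℂ) (hψ : ∀ x, ψ x = ζ ^ (Algebra.trace (ZMod p) F x).val) :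
    ∃ (k : ℕ) (b c : ℤ), 2 * k + h = f ∧ ¬ (p : ℤ) ∣ b ∧ ¬ (p : ℤ) ∣ c ∧
      b ^ 2 + (ℓ : ℤ) * c ^ 2 = 4 * (p : ℤ) ^ h ∧ b * (p : ℤ) ^ k ≡ -2 [ZMOD (ℓ : ℤ)] ∧
      gaussSum χ ψ = ((b : ℂ) + (c : ℂ) * Complex.I * (√ℓ : ℂ)) / 2 * (p : ℂ) ^ k := by
  have hp := (Fact.out : p.Prime)
  have hℓ := (Fact.out : ℓ.Prime)
  have hψ1 : ψ ≠ 1 := AddChar.ne_one_of_eq_pow_trace hζ hψ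
  have hN1 : 1 < ℓ ^ m := Nat.one_lt_pow (by omega) hℓ.one_lt
  have hχN : χ ^ ℓ ^ m = 1 := hχ ▸ pow_orderOf_eq_one χ
  have hχ1 : χ ≠ 1 := by rintro rfl; rw [orderOf_one] at hχ; omega
  set g := gaussSum χ ψ with hg
  set g' := gaussSum χ⁻¹ ψ⁻¹ with hg'
  have hstar : star g = g' := star_gaussSum_eq χ ψ
  set δ := Complex.I * (√ℓ : ℂ) with hδ
  have hδ2 : δ ^ 2 = -ℓ := by
    rw [hδ, mul_pow, Complex.I_sq, ← Complex.ofReal_pow, Real.sq_sqrt (Nat.cast_nonneg _)]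
    simp
  have hδstar : star δ = -δ := by simp [hδ]
  obtain ⟨a, b, hab⟩ := Submodule.mem_span_pair.1
    (gaussSum_mem_span_index_two hℓ4 hℓ3 hm hpℓ hf hf2 χ hχ hζ ψ hψ)
  rw [← hg, ← hδ, Rat.smul_def, Rat.smul_def, mul_one] at hab
  have hab' : (a : ℂ) - b * δ = g' := by
    rw [← hstar, ← hab, star_add, star_mul', hδstar]
    simp [sub_eq_add_neg]
  have hgi : IsIntegral ℤ g := isIntegral_gaussSum χ ψ
  have hgi' : IsIntegral ℤ g' := isIntegral_gaussSum _ _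
  obtain ⟨s, hs⟩ := Rat.exists_intCast_eq_of_isIntegral (L := ℂ) (r := 2 * a) (by
    have : ((2 * a : ℚ) : ℂ) = g + g' := by push_cast; linear_combination hab + hab'
    rw [this]; exact hgi.add hgi')
  obtain ⟨n, hn⟩ := Rat.exists_intCast_eq_of_isIntegral (L := ℂ) (r := ℓ * (2 * b) ^ 2) (by
    have : ((ℓ * (2 * b) ^ 2 : ℚ) : ℂ) = -(g - g') ^ 2 := by
      push_cast; rw [← hab, ← hab']; linear_combination 4 * (b : ℂ) ^ 2 * hδ2
    rw [this]; exact ((hgi.sub hgi').pow 2).neg)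
  obtain ⟨t, ht⟩ := Rat.exists_intCast_eq_of_prime_mul_sq hℓ hn.symm
  have hs' : (s : ℂ) = 2 * a := by exact_mod_cast congrArg (Rat.cast : ℚ → ℂ) hs
  have ht' : (t : ℂ) = 2 * b := by exact_mod_cast congrArg (Rat.cast : ℚ → ℂ) ht
  have hsg : (s : ℂ) = g + g' := by rw [hs', ← hab, ← hab']; ring
  have htg : (t : ℂ) * δ = g - g' := by rw [ht', ← hab, ← hab']; ring
  have hnorm : s ^ 2 + ℓ * t ^ 2 = 4 * (p : ℤ) ^ f := by
    have h1 : g * g' = (p : ℂ) ^ f := by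
      rw [hg, hg', gaussSum_mul_gaussSum_eq_card hχ1 (AddChar.IsPrimitive.of_ne_one hψ1), hF,
        Nat.cast_pow]
    have h2 : (s : ℂ) ^ 2 + ℓ * (t : ℂ) ^ 2 = 4 * (p : ℂ) ^ f := by
      rw [← h1]
      linear_combination (s + g + g') * hsg - (t * δ + g - g') * htg + (t : ℂ) ^ 2 * hδ2
    exact_mod_cast h2
  obtain ⟨A, hA⟩ := ValuationSubring.exists_natCast_mem_nonunits p hp
  rw [ValuationSubring.mem_nonunits_iff] at hA
  obtain ⟨k, hkf, hk⟩ := A.valuation_gaussSum_index_two hA hℓ4 hm hF hpℓ hf hf2 hh χ hχ hζ ψ hψ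
  have hp0 : 0 < A.valuation (p : ℂ) := by
    rw [Valuation.pos_iff]; exact_mod_cast hp.ne_zero
  have hlt : A.valuation (p : ℂ) ^ (k + h) < A.valuation (p : ℂ) ^ k :=
    (pow_right_strictAnti₀ hp0 hA) (by omega)
  have hpℓ' : ¬ (p : ℤ) ∣ (ℓ : ℤ) := by
    intro hd
    have hd : p ∣ ℓ ^ m := dvd_pow (by exact_mod_cast hd) (by omega)
    rw [Nat.Coprime, Nat.gcd_eq_left hd] at hpℓ
    exact hp.ne_one hpℓ
  have hvδ : A.valuation δ = 1 := by
    have h1 : A.valuation δ ^ 2 = 1 := by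
      rw [← map_pow, hδ2, Valuation.map_neg]
      exact_mod_cast A.valuation_intCast_eq_one hp hA hpℓ'
    exact (pow_eq_one_iff_of_nonneg zero_le (by norm_num)).1 h1
  have hvs : A.valuation (s : ℂ) = A.valuation (p : ℂ) ^ k := by
    rw [hsg]
    rcases hk with ⟨h1, h2⟩ | ⟨h1, h2⟩
    · rw [Valuation.map_add_eq_of_lt_left, h1]; rwa [h1, h2]
    · rw [Valuation.map_add_eq_of_lt_right, h2]; rwa [h1, h2]
  have hvt : A.valuation (t : ℂ) = A.valuation (p : ℂ) ^ k := by
    rw [← mul_one (A.valuation (t : ℂ)), ← hvδ, ← map_mul, htg]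
    rcases hk with ⟨h1, h2⟩ | ⟨h1, h2⟩
    · rw [Valuation.map_sub_eq_of_lt_left, h1]; rwa [h1, h2]
    · rw [Valuation.map_sub_eq_of_lt_right, h2]; rwa [h1, h2]
  obtain ⟨b', hb', hpb⟩ := A.exists_eq_mul_pow_of_valuation hp hA hvs
  obtain ⟨c', hc', hpc⟩ := A.exists_eq_mul_pow_of_valuation hp hA hvt
  refine ⟨k, b', c', hkf, hpb, hpc, ?_, ?_, ?_⟩
  · have hpk : ((p : ℤ) ^ k) ^ 2 ≠ 0 := by
      have := hp.ne_zero
      positivity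
    apply mul_left_cancel₀ hpk
    rw [hb', hc', ← hkf] at hnorm
    linear_combination hnorm
  · rw [← hb', Int.modEq_comm, Int.modEq_iff_dvd]
    obtain ⟨B, hB⟩ := ValuationSubring.exists_natCast_mem_nonunits ℓ hℓ
    rw [ValuationSubring.mem_nonunits_iff] at hB
    rw [← B.valuation_intCast_lt_one_iff hℓ hB]
    have h1 : ((s - -2 : ℤ) : ℂ) = (g + 1) + (g' + 1) := by push_cast; rw [hsg]; ring
    rw [h1]
    refine Valuation.map_add_lt _ (B.valuation_gaussSum_add_one_lt hℓ hB hχN hψ1)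
      (B.valuation_gaussSum_add_one_lt hℓ hB (m := m) ?_ ?_)
    · rw [inv_pow, hχN, inv_one]
    · simpa using hψ1
  · have h1 : g = (s + t * δ) / 2 := by rw [hsg, htg]; ring
    rw [h1, hb', hc', hδ]; push_cast; ring

end

lemma Real.abs_rpow_neg_sub_rpow_neg_le {c u v s t : ℝ} (hc : 0 < c) (hc1 : c ≤ 1) (ht : 1 ≤ t)
    (hu : c * t ≤ u) (hv : c * t ≤ v) (huv : |u - v| ≤ 1) (hs : 1 ≤ s) (hs2 : s ≤ 2) :
    |u ^ (-s) - v ^ (-s)| ≤ 2 / c ^ 3 * (1 / t ^ 2) := by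
  wlog h : u ≤ v generalizing u v
  · rw [abs_sub_comm]
    exact this hv hu (by rwa [abs_sub_comm]) (le_of_not_ge h)
  have ht0 : 0 < t := by linarith
  have hct : 0 < c * t := by positivity
  have hu0 : 0 < u := by linarith
  have hv0 : 0 < v := by linarith
  have huv' : v - u ≤ 1 := by
    have := abs_le.mp huv
    linarith [this.1]
  have h1 : u ^ (-s) ≤ 1 / (c ^ 2 * t) := by
    rcases le_total 1 u with h1u | h1u
    · calc u ^ (-s) ≤ u ^ (-1 : ℝ) := Real.rpow_le_rpow_of_exponent_le h1u (by linarith)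
        _ = 1 / u := by rw [Real.rpow_neg_one, one_div]
        _ ≤ 1 / (c * t) := one_div_le_one_div_of_le hct hu
        _ ≤ 1 / (c ^ 2 * t) := one_div_le_one_div_of_le (by positivity) (by
            gcongr
            nlinarith)
    · calc u ^ (-s) ≤ u ^ (-2 : ℝ) := Real.rpow_le_rpow_of_exponent_ge hu0 h1u (by linarith)
        _ = 1 / u ^ 2 := by rw [Real.rpow_neg hu0.le, one_div]; norm_cast
        _ ≤ 1 / (c * t) ^ 2 := one_div_le_one_div_of_le (by positivity) (by gcongr)
        _ ≤ 1 / (c ^ 2 * t) := one_div_le_one_div_of_le (by positivity) (by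
            rw [mul_pow]
            gcongr
            nlinarith)
  have h2 : v ^ (-s) = u ^ (-s) * (u / v) ^ s := by
    rw [Real.div_rpow hu0.le hv0.le, Real.rpow_neg hu0.le, Real.rpow_neg hv0.le]
    have := Real.rpow_pos_of_pos hu0 s
    field_simp
  have h3 : (u / v) ^ (2 : ℕ) ≤ (u / v) ^ s := by
    rw [← Real.rpow_natCast]
    exact Real.rpow_le_rpow_of_exponent_ge (by positivity) ((div_le_one hv0).mpr h)
      (by push_cast; linarith)
  have h4 : (u / v) ^ s ≤ 1 :=
    Real.rpow_le_one (by positivity) ((div_le_one hv0).mpr h) (by linarith)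
  have h5 : 1 - (u / v) ^ 2 ≤ 2 / (c * t) := by
    have e : 1 - (u / v) ^ 2 = (1 - u / v) * (1 + u / v) := by ring
    have h6 : 1 - u / v ≤ 1 / v := by
      rw [one_sub_div hv0.ne']
      gcongr
    have h7 : u / v ≤ 1 := (div_le_one hv0).mpr h
    have h8 : 1 / v ≤ 1 / (c * t) := one_div_le_one_div_of_le hct hv
    have h9 : 0 ≤ u / v := by positivity
    calc _ = (1 - u / v) * (1 + u / v) := e
      _ ≤ (1 / (c * t)) * 2 := by gcongr <;> linarith
      _ = _ := by ring
  have h0 : 0 ≤ u ^ (-s) := Real.rpow_nonneg hu0.le _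
  rw [h2, abs_of_nonneg (by nlinarith)]
  calc u ^ (-s) - u ^ (-s) * (u / v) ^ s = u ^ (-s) * (1 - (u / v) ^ s) := by ring
    _ ≤ 1 / (c ^ 2 * t) * (2 / (c * t)) := by
        gcongr
        · linarith
    _ = _ := by field_simp

open Filter Topology in
lemma HurwitzZeta.hurwitzZetaOdd_one {a : ℝ} (ha0 : 0 < a) (ha1 : a < 1) :
    HurwitzZeta.hurwitzZetaOdd a 1 = (Real.pi : ℂ) / 2 * Complex.cot (Real.pi * a) := by
  have hcont : Tendsto (fun s : ℝ ↦ HurwitzZeta.hurwitzZetaOdd a (s : ℂ)) (𝓝[>] 1)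
      (𝓝 (HurwitzZeta.hurwitzZetaOdd a 1)) := by
    have h := ((HurwitzZeta.differentiable_hurwitzZetaOdd a).continuous.comp
      Complex.continuous_ofReal).tendsto 1
    simp only [Function.comp_apply, Complex.ofReal_one] at h
    exact h.mono_left nhdsWithin_le_nhds
  set c := min a (1 - a)
  have hc : 0 < c := lt_min ha0 (by linarith)
  have hca : c ≤ a := min_le_left _ _
  have hca' : c ≤ 1 - a := min_le_right _ _
  have hterm (s : ℝ) (n : ℕ) : (1 / (n + a : ℂ) ^ (s : ℂ) - 1 / (n + 1 - a : ℂ) ^ (s : ℂ)) / 2 =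
      ((((n + a) ^ (-s) - (n + 1 - a) ^ (-s)) / 2 : ℝ) : ℂ) := by
    have h1 : (0 : ℝ) ≤ n + a := by positivity
    have h2 : (0 : ℝ) ≤ n + 1 - a := by linarith [(Nat.cast_nonneg n : (0 : ℝ) ≤ n)]
    push_cast
    rw [Real.rpow_neg h1, Real.rpow_neg h2]
    push_cast [Complex.ofReal_cpow h1, Complex.ofReal_cpow h2]
    simp only [one_div]
  have hbound (n : ℕ) (s : ℝ) (hs : 1 ≤ s) (hs2 : s ≤ 2) :
      ‖(1 / (n + a : ℂ) ^ (s : ℂ) - 1 / (n + 1 - a : ℂ) ^ (s : ℂ)) / 2‖ ≤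
        2 / c ^ 3 * (1 / ((n : ℝ) + 1) ^ 2) := by
    have hn : (0 : ℝ) ≤ n := Nat.cast_nonneg n
    have := Real.abs_rpow_neg_sub_rpow_neg_le (c := c) (u := n + a) (v := n + 1 - a)
      (t := n + 1) (s := s) hc (by linarith) (by linarith) (by nlinarith) (by nlinarith)
      (abs_le.mpr ⟨by linarith, by linarith⟩) hs hs2
    rw [hterm, Complex.norm_real, Real.norm_eq_abs, abs_div, abs_two]
    linarith [abs_nonneg (((n : ℝ) + a) ^ (-s) - (n + 1 - a) ^ (-s))]
  have hsum : Summable fun n : ℕ ↦ 2 / c ^ 3 * (1 / ((n : ℝ) + 1) ^ 2) := by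
    refine Summable.mul_left _ ?_
    have := (summable_nat_add_iff 1).mpr (Real.summable_one_div_nat_pow.mpr (one_lt_two))
    exact_mod_cast this
  have hlim : Tendsto (fun s : ℝ ↦ ∑' n : ℕ,
        (1 / (n + a : ℂ) ^ (s : ℂ) - 1 / (n + 1 - a : ℂ) ^ (s : ℂ)) / 2) (𝓝[>] 1)
      (𝓝 (∑' n : ℕ, (1 / (n + a : ℂ) - 1 / (n + 1 - a : ℂ)) / 2)) := by
    refine tendsto_tsum_of_dominated_convergence hsum (fun n ↦ ?_) ?_
    · have h1 : (n + a : ℂ) ≠ 0 := by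
        have : (0 : ℝ) < n + a := by positivity
        exact_mod_cast this.ne'
      have h2 : (n + 1 - a : ℂ) ≠ 0 := by
        have : (0 : ℝ) < n + 1 - a := by linarith [(Nat.cast_nonneg n : (0 : ℝ) ≤ n)]
        exact_mod_cast this.ne'
      have hc1 : ContinuousAt (fun s : ℝ ↦
          (1 / (n + a : ℂ) ^ (s : ℂ) - 1 / (n + 1 - a : ℂ) ^ (s : ℂ)) / 2) 1 := by
        have e1 : ContinuousAt (fun s : ℝ ↦ (n + a : ℂ) ^ (s : ℂ)) 1 :=
          Complex.continuous_ofReal.continuousAt.const_cpow (Or.inl h1)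
        have e2 : ContinuousAt (fun s : ℝ ↦ (n + 1 - a : ℂ) ^ (s : ℂ)) 1 :=
          Complex.continuous_ofReal.continuousAt.const_cpow (Or.inl h2)
        refine ((continuousAt_const.div e1 ?_).sub (continuousAt_const.div e2 ?_)).div_const _
        · simp [h1]
        · simp [h2]
      have := hc1.tendsto
      simp only [Complex.ofReal_one, Complex.cpow_one] at this
      exact this.mono_left nhdsWithin_le_nhds
    · filter_upwards [Ioo_mem_nhdsGT (show (1 : ℝ) < 2 by norm_num)] with s hs n
      exact hbound n s hs.1.le hs.2.le
  have heq : (fun s : ℝ ↦ HurwitzZeta.hurwitzZetaOdd a (s : ℂ)) =ᶠ[𝓝[>] 1] fun s : ℝ ↦ ∑' n : ℕ,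
        (1 / (n + a : ℂ) ^ (s : ℂ) - 1 / (n + 1 - a : ℂ) ^ (s : ℂ)) / 2 := by
    filter_upwards [self_mem_nhdsWithin] with s hs
    exact (HurwitzZeta.hasSum_nat_hurwitzZetaOdd_of_mem_Icc ⟨ha0.le, ha1.le⟩
      (by simpa using hs)).tsum_eq.symm
  have hval := tendsto_nhds_unique hcont (hlim.congr' heq.symm)
  have haZ : (a : ℂ) ∈ Complex.integerComplement := by
    rintro ⟨n, hn⟩
    have hn' : (n : ℝ) = a := by exact_mod_cast hn
    have h1 : (0 : ℝ) < n := by linarith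
    have h2 : (n : ℝ) < 1 := by linarith
    norm_cast at h1 h2
    omega
  have hs1 : Summable fun n : ℕ ↦ (1 / (n + a : ℂ) - 1 / (n + 1 - a : ℂ)) / 2 := by
    refine Summable.of_norm_bounded hsum (fun n ↦ ?_)
    simpa using hbound n 1 le_rfl one_le_two
  have hpart (M : ℕ) : ∑ n ∈ Finset.range M, (1 / (n + a : ℂ) - 1 / (n + 1 - a : ℂ)) / 2 =
      (1 / a + ∑ n ∈ Finset.range M, (1 / ((a : ℂ) - (n + 1)) + 1 / (a + (n + 1)))
        - 1 / (a + M)) / 2 := by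
    induction M with
    | zero => simp
    | succ M ih =>
      rw [Finset.sum_range_succ, Finset.sum_range_succ, ih]
      have : 1 / ((a : ℂ) - (M + 1)) = - (1 / (M + 1 - a)) := by
        rw [← one_div_neg_eq_neg_one_div]; congr 1; ring
      rw [this]
      push_cast
      ring
  have hz : Tendsto (fun M : ℕ ↦ 1 / ((a : ℂ) + M)) atTop (𝓝 0) := by
    have h1 : Tendsto (fun M : ℕ ↦ 1 / (a + M : ℝ)) atTop (𝓝 0) := by
      simp only [one_div]
      exact tendsto_inv_atTop_zero.comp
        (tendsto_atTop_add_const_left _ _ tendsto_natCast_atTop_atTop)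
    have := (Complex.continuous_ofReal.tendsto 0).comp h1
    simpa [Function.comp_def] using this
  have hcot := (summable_cotTerm haZ).hasSum.tendsto_sum_nat
  have hc2 : ∑' n : ℕ, cotTerm (a : ℂ) n = Real.pi * Complex.cot (Real.pi * a) - 1 / a :=
    (cot_series_rep' haZ).symm
  rw [hc2] at hcot
  have hfin : Tendsto (fun M : ℕ ↦
      ∑ n ∈ Finset.range M, (1 / (n + a : ℂ) - 1 / (n + 1 - a : ℂ)) / 2) atTop
      (𝓝 ((1 / a + (Real.pi * Complex.cot (Real.pi * a) - 1 / a) - 0) / 2)) := by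
    simp only [hpart]
    exact ((hcot.const_add _).sub hz).div_const _
  rw [hval, tendsto_nhds_unique hs1.hasSum.tendsto_sum_nat hfin]
  ring

lemma sum_range_mul_pow_of_pow_eq_one {K : Type*} [Field K] {n : ℕ} {z : K} (hz : z ^ n = 1)
    (hz1 : z ≠ 1) : ∑ r ∈ Finset.range n, (r : K) * z ^ r = n / (z - 1) := by
  have h1 : z - 1 ≠ 0 := sub_ne_zero.mpr hz1
  have key (M : ℕ) : (z - 1) * ∑ r ∈ Finset.range M, (r : K) * z ^ r =
      M * z ^ M - ∑ r ∈ Finset.range M, z ^ (r + 1) := by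
    induction M with
    | zero => simp
    | succ M ih =>
      rw [Finset.sum_range_succ, Finset.sum_range_succ, mul_add, ih]
      push_cast
      ring
  have h2 : ∑ r ∈ Finset.range n, z ^ (r + 1) = 0 := by
    have := geom_sum_mul z n
    rw [hz, sub_self] at this
    have h3 := (mul_eq_zero.mp this).resolve_right h1
    simp_rw [pow_succ, ← Finset.sum_mul, h3, zero_mul]
  rw [eq_div_iff h1, mul_comm, key, hz, h2]
  ring

/-- The Legendre symbol as a complex Dirichlet character. -/
noncomputable def legendreCharacter (ℓ : ℕ) [Fact ℓ.Prime] : DirichletCharacter ℂ ℓ :=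
  (quadraticChar (ZMod ℓ)).ringHomComp (Int.castRingHom ℂ)

lemma legendreCharacter_intCast (ℓ : ℕ) [Fact ℓ.Prime] (a : ℤ) :
    legendreCharacter ℓ (a : ZMod ℓ) = (legendreSym ℓ a : ℂ) := rfl

lemma legendreCharacter_natCast (ℓ : ℕ) [Fact ℓ.Prime] (a : ℕ) :
    legendreCharacter ℓ (a : ZMod ℓ) = (legendreSym ℓ a : ℂ) := by
  rw [← legendreCharacter_intCast, Int.cast_natCast]

lemma legendreCharacter_ne_one {ℓ : ℕ} [Fact ℓ.Prime] (hℓ : ℓ ≠ 2) : legendreCharacter ℓ ≠ 1 := by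
  rw [legendreCharacter, Ne, MulChar.ringHomComp_eq_one_iff Int.cast_injective]
  exact quadraticChar_ne_one (by rwa [ZMod.ringChar_zmod_n])

lemma legendreCharacter_isQuadratic (ℓ : ℕ) [Fact ℓ.Prime] :
    (legendreCharacter ℓ).IsQuadratic :=
  (quadraticChar_isQuadratic (ZMod ℓ)).comp _

open Complex in
lemma LFunction_legendreCharacter_one {ℓ : ℕ} [Fact ℓ.Prime] (hℓ4 : ℓ % 4 = 3) :
    DirichletCharacter.LFunction (legendreCharacter ℓ) 1 =
      -(Real.pi / (ℓ ^ 2 * I)) * gaussSum (legendreCharacter ℓ) ZMod.stdAddChar *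
        ((∑ r ∈ Finset.range ℓ, legendreSym ℓ r * (r : ℤ) : ℤ) : ℂ) := by
  have hℓ2 : ℓ ≠ 2 := by rintro rfl; norm_num at hℓ4
  have hℓ0 : (ℓ : ℂ) ≠ 0 := Nat.cast_ne_zero.mpr (NeZero.ne ℓ)
  have hodd : Function.Odd (legendreCharacter ℓ) := fun a ↦ by
    have h1 : legendreCharacter ℓ (-1) = -1 := by
      have := legendreCharacter_intCast ℓ (-1)
      rw [legendreSym_neg_one_of_mod_four_eq_three hℓ4] at this
      simpa using this
    rw [neg_eq_neg_one_mul, map_mul, h1, neg_one_mul]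
  have hχ0 : legendreCharacter ℓ 0 = 0 := MulChar.map_zero _
  have hterm (j : ZMod ℓ) : legendreCharacter ℓ j *
      HurwitzZeta.hurwitzZetaOdd (ZMod.toAddCircle j) 1 =
      -(Real.pi / (2 * I)) * legendreCharacter ℓ j - Real.pi / (ℓ * I) *
        ∑ r ∈ Finset.range ℓ, (r : ℂ) *
          (legendreCharacter ℓ j * ZMod.stdAddChar ((r : ZMod ℓ) * j)) := by
    rcases eq_or_ne j 0 with rfl | hj
    · simp [hχ0]
    set E : ℂ := ZMod.stdAddChar j with hE
    have hE1 : E ≠ 1 := by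
      rw [hE, ← AddChar.map_zero_eq_one (ZMod.stdAddChar (N := ℓ))]
      exact fun h ↦ hj (ZMod.injective_stdAddChar h)
    have hEr (r : ℕ) : ZMod.stdAddChar ((r : ZMod ℓ) * j) = E ^ r := by
      rw [← nsmul_eq_mul, AddChar.map_nsmul_eq_pow]
    have hEℓ : E ^ ℓ = 1 := by
      rw [← hEr]; simp
    have hv : ((j.val : ℕ) : ZMod ℓ) = j := ZMod.natCast_zmod_val j
    have hEexp : E = exp (2 * I * (Real.pi * ((j.val / ℓ : ℝ) : ℂ))) := by
      have := ZMod.stdAddChar_coe (N := ℓ) (j.val : ℤ)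
      rw [Int.cast_natCast, hv] at this
      rw [hE, this]
      push_cast
      congr 1
      ring
    have hj0 : 0 < j.val := by
      rw [Nat.pos_iff_ne_zero, Ne, ZMod.val_eq_zero]; exact hj
    have hjl : j.val < ℓ := ZMod.val_lt j
    have hℓpos : (0 : ℝ) < ℓ := by exact_mod_cast (NeZero.pos ℓ)
    have hH : HurwitzZeta.hurwitzZetaOdd (ZMod.toAddCircle j) 1 =
        Real.pi / 2 * ((E + 1) / (I * (1 - E))) := by
      rw [hEexp, ← Complex.cot_eq_exp_ratio, ← HurwitzZeta.hurwitzZetaOdd_one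
        (by positivity) ((div_lt_one hℓpos).mpr (by exact_mod_cast hjl)),
        ← ZMod.toAddCircle_natCast, hv]
    simp only [hEr]
    have hs : ∑ r ∈ Finset.range ℓ, (r : ℂ) * (legendreCharacter ℓ j * E ^ r) =
        legendreCharacter ℓ j * (ℓ / (E - 1)) := by
      rw [← sum_range_mul_pow_of_pow_eq_one hEℓ hE1, Finset.mul_sum]
      exact Finset.sum_congr rfl fun _ _ ↦ by ring
    rw [hH, hs]
    have h1 : E - 1 ≠ 0 := sub_ne_zero.mpr hE1
    have h2 : 1 - E ≠ 0 := sub_ne_zero.mpr hE1.symm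
    have hI := I_ne_zero
    rw [show 1 - E = -(E - 1) by ring]
    field_simp
    ring
  have hsum0 : ∑ j : ZMod ℓ, legendreCharacter ℓ j = 0 :=
    MulChar.sum_eq_zero_of_ne_one (legendreCharacter_ne_one hℓ2)
  have hG (r : ℕ) : ∑ j : ZMod ℓ, legendreCharacter ℓ j * ZMod.stdAddChar ((r : ZMod ℓ) * j) =
      legendreCharacter ℓ r * gaussSum (legendreCharacter ℓ) ZMod.stdAddChar := by
    by_cases hr : (r : ZMod ℓ) = 0
    · simp [hr, hsum0, hχ0]
    · have := gaussSum_mulShift_eq (legendreCharacter ℓ) (ZMod.stdAddChar) (Units.mk0 _ hr)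
      rw [(legendreCharacter_isQuadratic ℓ).inv] at this
      simpa [gaussSum, AddChar.mulShift_apply] using this
  rw [DirichletCharacter.LFunction, ZMod.LFunction_def_odd hodd]
  simp only [hterm]
  rw [Finset.sum_sub_distrib, ← Finset.mul_sum, hsum0, ← Finset.mul_sum, Finset.sum_comm]
  simp only [← Finset.mul_sum, hG, legendreCharacter_natCast]
  rw [Complex.cpow_neg_one]
  push_cast
  simp only [← mul_assoc, ← Finset.sum_mul]
  have : ∑ r ∈ Finset.range ℓ, (r : ℂ) * (legendreSym ℓ r : ℂ) =
    ∑ r ∈ Finset.range ℓ, (legendreSym ℓ r : ℂ) * r := Finset.sum_congr rfl fun _ _ ↦ mul_comm _ _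
  rw [this]
  have hI := I_ne_zero
  field_simp
  ring

lemma norm_LFunction_legendreCharacter_one {ℓ : ℕ} [Fact ℓ.Prime] (hℓ4 : ℓ % 4 = 3) :
    ‖DirichletCharacter.LFunction (legendreCharacter ℓ) 1‖ * √ℓ =
      Real.pi / ℓ * (|∑ r ∈ Finset.range ℓ, legendreSym ℓ r * (r : ℤ)| : ℤ) := by
  have hℓ2 : ℓ ≠ 2 := by rintro rfl; norm_num at hℓ4
  have hg : ‖gaussSum (legendreCharacter ℓ) (ZMod.stdAddChar (N := ℓ))‖ = √ℓ := by
    have h1 := gaussSum_sq (χ := legendreCharacter ℓ) (legendreCharacter_ne_one hℓ2)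
      (legendreCharacter_isQuadratic ℓ)
      (ZMod.isPrimitive_stdAddChar ℓ)
    have h2 := congrArg norm h1
    have h3 : legendreCharacter ℓ (-1) = -1 := by
      have := legendreCharacter_intCast ℓ (-1)
      rw [legendreSym_neg_one_of_mod_four_eq_three hℓ4] at this
      simpa using this
    rw [h3, norm_pow, norm_mul, norm_neg, norm_one, one_mul, ZMod.card, Complex.norm_natCast] at h2
    rw [← h2, Real.sqrt_sq (norm_nonneg _)]
  have hℓ0 : (ℓ : ℝ) ≠ 0 := Nat.cast_ne_zero.mpr (NeZero.ne ℓ)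
  rw [LFunction_legendreCharacter_one hℓ4, norm_mul, norm_mul, hg, norm_neg, norm_div, norm_mul,
    norm_pow, Complex.norm_I, Complex.norm_natCast, Complex.norm_real, Complex.norm_intCast,
    Real.norm_of_nonneg Real.pi_pos.le, Int.cast_abs]
  have h : √(ℓ : ℝ) * √ℓ = ℓ := Real.mul_self_sqrt (Nat.cast_nonneg ℓ)
  calc _ = Real.pi / (ℓ ^ 2 * 1) * |((∑ r ∈ Finset.range ℓ, legendreSym ℓ r * (r : ℤ) : ℤ) : ℝ)|
        * (√(ℓ : ℝ) * √ℓ) := by ring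
    _ = _ := by rw [h]; field_simp

section QuadraticField

variable {K : Type*} [Field K] [NumberField K] {ℓ : ℕ}

lemma exists_rat_add_rat_mul_of_sq_eq_neg (hℓ : 0 < ℓ) (hK : Module.finrank ℚ K = 2) {α : K}
    (hα : α ^ 2 = -(ℓ : K)) (x : K) : ∃ s t : ℚ, x = s + t * α := by
  have hli : LinearIndependent ℚ ![(1 : K), α] := by
    rw [LinearIndependent.pair_iff]
    intro s t h
    have hℓ' : (0 : ℚ) < ℓ := by exact_mod_cast hℓ
    have h1 : (s : K) + t * α = 0 := by simpa [Algebra.smul_def] using h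
    have h2 : (s : K) ^ 2 + ℓ * (t : K) ^ 2 = 0 := by
      linear_combination (s - t * α) * h1 + (t : K) ^ 2 * hα
    have h3 : s ^ 2 + ℓ * t ^ 2 = 0 := by exact_mod_cast h2
    have ht : t = 0 := by
      by_contra h0
      have := sq_nonneg s
      have : 0 < t ^ 2 := by positivity
      nlinarith
    subst ht
    simpa using h3
  let b := basisOfLinearIndependentOfCardEqFinrank hli (by simp [hK])
  refine ⟨b.repr x 0, b.repr x 1, ?_⟩
  have := b.sum_repr x
  rw [Fin.sum_univ_two] at this
  simpa [b, Algebra.smul_def] using this.symm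

open Complex ComplexConjugate in
lemma exists_int_of_isIntegral_quadratic (hℓ : ℓ.Prime) (hℓ4 : ℓ % 4 = 3)
    (hK : Module.finrank ℚ K = 2) {α : K} (hα : α ^ 2 = -(ℓ : K)) {x : K} (hx : IsIntegral ℤ x) :
    ∃ m n : ℤ, x = m + n * ((1 + α) / 2) := by
  obtain ⟨s, t, hst⟩ := exists_rat_add_rat_mul_of_sq_eq_neg hℓ.pos hK hα x
  let φ : K →+* ℂ := Classical.arbitrary _
  have hφα : conj (φ α) = -φ α := by
    have h1 : φ α ^ 2 = -(ℓ : ℂ) := by rw [← map_pow, hα]; simp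
    have h2 : (φ α) ^ 2 = (I * (√ℓ : ℂ)) ^ 2 := by
      rw [h1, mul_pow, I_sq, ← ofReal_pow, Real.sq_sqrt (Nat.cast_nonneg _)]
      simp
    rcases sq_eq_sq_iff_eq_or_eq_neg.mp h2 with h | h <;> rw [h] <;> simp
  have hφx : φ x = s + t * φ α := by rw [hst]; simp
  have hcx : conj (φ x) = s - t * φ α := by
    rw [hφx, map_add, map_mul, hφα]; simp; ring
  have hi1 : IsIntegral ℤ (φ x) := map_isIntegral_int φ hx
  have hi2 : IsIntegral ℤ (conj (φ x)) := map_isIntegral_int (starRingEnd ℂ) hi1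
  have hsqα : φ α ^ 2 = -(ℓ : ℂ) := by rw [← map_pow, hα]; simp
  obtain ⟨S, hS⟩ : ∃ S : ℤ, (S : ℚ) = 2 * s := by
    refine Rat.exists_intCast_eq_of_isIntegral (L := ℂ) ?_
    have h : ((2 * s : ℚ) : ℂ) = φ x + conj (φ x) := by rw [hcx, hφx]; push_cast; ring
    exact h ▸ hi1.add hi2
  obtain ⟨n, hn⟩ : ∃ n : ℤ, (n : ℚ) = ℓ * (2 * t) ^ 2 := by
    refine Rat.exists_intCast_eq_of_isIntegral (L := ℂ) ?_
    have h : ((ℓ * (2 * t) ^ 2 : ℚ) : ℂ) = -(φ x - conj (φ x)) ^ 2 := by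
      rw [hcx, hφx]
      push_cast
      linear_combination (4 * (t : ℂ) ^ 2) * hsqα
    exact h ▸ ((hi1.sub hi2).pow 2).neg
  obtain ⟨T, hT⟩ := Rat.exists_intCast_eq_of_prime_mul_sq hℓ hn.symm
  obtain ⟨M, hM⟩ : ∃ M : ℤ, (M : ℚ) = s ^ 2 + ℓ * t ^ 2 := by
    refine Rat.exists_intCast_eq_of_isIntegral (L := ℂ) ?_
    have h : ((s ^ 2 + ℓ * t ^ 2 : ℚ) : ℂ) = φ x * conj (φ x) := by
      rw [hcx, hφx]
      push_cast
      linear_combination ((t : ℂ) ^ 2) * hsqα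
    exact h ▸ hi1.mul hi2
  have hpar : S ^ 2 + ℓ * T ^ 2 = 4 * M := by
    have : (S : ℚ) ^ 2 + ℓ * (T : ℚ) ^ 2 = 4 * M := by
      rw [hS, hT, hM]; ring
    exact_mod_cast this
  have h2 : (2 : ℤ) ∣ S - T := by
    obtain ⟨k, hk⟩ : ∃ k, ℓ = 4 * k + 3 := ⟨ℓ / 4, by omega⟩
    have h4 : S ^ 2 - T ^ 2 = 4 * (M - k * T ^ 2 - T ^ 2) := by
      rw [hk] at hpar; push_cast at hpar; linarith
    have h5 : Even (S ^ 2 - T ^ 2) := ⟨2 * (M - k * T ^ 2 - T ^ 2), by rw [h4]; ring⟩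
    have h6 : Even (S - T) := by
      simpa [Int.even_sub, Int.even_pow] using h5
    exact h6.two_dvd
  obtain ⟨m, hm⟩ := h2
  refine ⟨m, T, ?_⟩
  have hs' : (s : K) = S / 2 := by
    have : s = S / 2 := by rw [hS]; ring
    rw [this]; push_cast; ring
  have ht' : (t : K) = T / 2 := by
    have : t = T / 2 := by rw [hT]; ring
    rw [this]; push_cast; ring
  have hm' : (S : K) = 2 * m + T := by
    have : S = 2 * m + T := by linarith
    rw [this]; push_cast; ring
  rw [hst, hs', ht', hm']
  ring

open NumberField in
lemma exists_omega_ringOfIntegers (hℓ : ℓ.Prime) (hℓ4 : ℓ % 4 = 3)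
    (hK : Module.finrank ℚ K = 2) {α : K} (hα : α ^ 2 = -(ℓ : K)) :
    ∃ ω : 𝓞 K, ω * ω = ω - ((ℓ + 1) / 4 : ℕ) ∧ ∀ x : 𝓞 K, ∃ m n : ℤ, x = m + n * ω := by
  have hc : ((ℓ + 1) / 4 : ℕ) * 4 = ℓ + 1 := by omega
  have hc' : (((ℓ + 1) / 4 : ℕ) : K) * 4 = ℓ + 1 := by exact_mod_cast hc
  set c := (ℓ + 1) / 4
  have hω : ((1 + α) / 2) * ((1 + α) / 2) = (1 + α) / 2 - (c : K) := by
    linear_combination hα / 4 + hc' / 4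
  have hωint : IsIntegral ℤ ((1 + α) / 2) := by
    refine ⟨Polynomial.X ^ 2 - Polynomial.X + Polynomial.C (c : ℤ), ?_, ?_⟩
    · monicity!
    · simp only [Polynomial.eval₂_add, Polynomial.eval₂_sub, Polynomial.eval₂_pow,
        Polynomial.eval₂_X, Polynomial.eval₂_C]
      rw [pow_two, hω]
      simp
  let ω : 𝓞 K := ⟨_, hωint⟩
  have hωc : algebraMap (𝓞 K) K ω = (1 + α) / 2 := rfl
  refine ⟨ω, ?_, fun x ↦ ?_⟩
  · apply RingOfIntegers.ext
    change algebraMap (𝓞 K) K (ω * ω) = algebraMap (𝓞 K) K (ω - c)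
    rw [map_mul, map_sub, hωc, map_natCast, hω]
  · obtain ⟨m, n, h⟩ := exists_int_of_isIntegral_quadratic hℓ hℓ4 hK hα x.2
    refine ⟨m, n, RingOfIntegers.ext ?_⟩
    change algebraMap (𝓞 K) K x = algebraMap (𝓞 K) K (m + n * ω)
    rw [map_add, map_mul, hωc, map_intCast, map_intCast]
    exact h

end QuadraticField

section IdealCount

variable {S : Type*} [CommRing S]

lemma Ideal.sup_span_natCast_eq_top {I : Ideal S} {m n : ℕ} (hmn : m.Coprime n)
    (h : (m : S) ∈ I) : I ⊔ Ideal.span {(n : S)} = ⊤ := by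
  rw [Ideal.eq_top_iff_one]
  have h1 : (m : S) * (m.gcdA n : S) + n * (m.gcdB n : S) = 1 := by
    have := Nat.gcd_eq_gcd_ab m n
    rw [hmn.gcd_eq_one] at this
    have h2 := congrArg (Int.cast : ℤ → S) this
    push_cast at h2
    exact h2.symm
  rw [← h1]
  exact Ideal.add_mem _ (Ideal.mem_sup_left (Ideal.mul_mem_right _ _ h))
    (Ideal.mem_sup_right (Ideal.mul_mem_right _ _ (Ideal.mem_span_singleton_self _)))

lemma Ideal.eq_mul_sup_span_of_coprime {J L : Ideal S} {m n : ℕ} (hmn : m.Coprime n)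
    (hJ : (m : S) ∈ J) (hL : (n : S) ∈ L) : J = J * L ⊔ Ideal.span {(m : S)} := by
  refine le_antisymm ?_ (sup_le Ideal.mul_le_left ?_)
  · calc J = J * (L ⊔ Ideal.span {(m : S)}) := by
          rw [Ideal.sup_span_natCast_eq_top hmn.symm hL, Ideal.mul_top]
      _ = J * L ⊔ J * Ideal.span {(m : S)} := Ideal.mul_sup _ _ _
      _ ≤ _ := sup_le_sup_left Ideal.mul_le_right _
  · rwa [Ideal.span_singleton_le_iff_mem]

lemma Ideal.sup_span_mul_sup_span_of_coprime {I : Ideal S} {m n : ℕ} (hmn : m.Coprime n)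
    (hI : ((m * n : ℕ) : S) ∈ I) :
    (I ⊔ Ideal.span {(m : S)}) * (I ⊔ Ideal.span {(n : S)}) = I := by
  apply le_antisymm
  · rw [Ideal.sup_mul]
    refine sup_le Ideal.mul_le_left ?_
    rw [Ideal.mul_sup]
    refine sup_le Ideal.mul_le_right ?_
    rw [Ideal.span_mul_span', Set.singleton_mul_singleton, Ideal.span_singleton_le_iff_mem]
    exact_mod_cast hI
  · have h : Ideal.span {(m : S)} ⊔ Ideal.span {(n : S)} = ⊤ :=
      Ideal.sup_span_natCast_eq_top hmn (Ideal.mem_span_singleton_self _)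
    calc I = (Ideal.span {(m : S)} ⊔ Ideal.span {(n : S)}) * I := by rw [h, Ideal.top_mul]
      _ = Ideal.span {(m : S)} * I ⊔ I * Ideal.span {(n : S)} := by
          rw [Ideal.sup_mul, mul_comm I]
      _ ≤ _ := sup_le (Ideal.mul_mono le_sup_right le_sup_left)
          (Ideal.mul_mono le_sup_left le_sup_right)

variable [IsDedekindDomain S] [Module.Free ℤ S]

lemma Ideal.natCast_mem_of_absNorm_eq {I : Ideal S} {n : ℕ} (h : Ideal.absNorm I = n) :
    (n : S) ∈ I := h ▸ Ideal.absNorm_mem I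

variable [Module.Finite ℤ S]

lemma Ideal.coprime_absNorm_of_mem {I : Ideal S} {m n : ℕ} (hmn : m.Coprime n)
    (h : (m : S) ∈ I) : (Ideal.absNorm I).Coprime n := by
  have h1 : Ideal.absNorm I ∣ m ^ Module.finrank ℤ S := by
    rw [← Ideal.absNorm_span_natCast]
    exact Ideal.absNorm_dvd_absNorm_of_le ((Ideal.span_singleton_le_iff_mem _).mpr h)
  exact Nat.Coprime.coprime_dvd_left h1 (Nat.Coprime.pow_left _ hmn)

lemma Ideal.card_absNorm_eq_mul_of_coprime {m n : ℕ} (hmn : m.Coprime n) :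
    Nat.card {I : Ideal S // Ideal.absNorm I = m * n} =
      Nat.card {I : Ideal S // Ideal.absNorm I = m} *
        Nat.card {I : Ideal S // Ideal.absNorm I = n} := by
  rw [← Nat.card_prod]
  symm
  refine Nat.card_eq_of_bijective (f := fun x :
    {I : Ideal S // Ideal.absNorm I = m} × {I : Ideal S // Ideal.absNorm I = n} ↦
      (⟨x.1.1 * x.2.1, by rw [map_mul, x.1.2, x.2.2]⟩ :
        {I : Ideal S // Ideal.absNorm I = m * n})) ⟨?_, ?_⟩
  · rintro ⟨⟨J, hJ⟩, ⟨L, hL⟩⟩ ⟨⟨J', hJ'⟩, ⟨L', hL'⟩⟩ h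
    have h : J * L = J' * L' := by simpa using h
    have e1 := Ideal.eq_mul_sup_span_of_coprime hmn (Ideal.natCast_mem_of_absNorm_eq hJ)
      (Ideal.natCast_mem_of_absNorm_eq hL)
    have e2 := Ideal.eq_mul_sup_span_of_coprime hmn (Ideal.natCast_mem_of_absNorm_eq hJ')
      (Ideal.natCast_mem_of_absNorm_eq hL')
    have e3 := Ideal.eq_mul_sup_span_of_coprime hmn.symm (Ideal.natCast_mem_of_absNorm_eq hL)
      (Ideal.natCast_mem_of_absNorm_eq hJ)
    have e4 := Ideal.eq_mul_sup_span_of_coprime hmn.symm (Ideal.natCast_mem_of_absNorm_eq hL')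
      (Ideal.natCast_mem_of_absNorm_eq hJ')
    have hJJ : J = J' := by rw [e1, e2, h]
    have hLL : L = L' := by rw [e3, e4, mul_comm, h, mul_comm]
    subst hJJ hLL
    rfl
  · rintro ⟨I, hI⟩
    have hmul := Ideal.sup_span_mul_sup_span_of_coprime hmn (Ideal.natCast_mem_of_absNorm_eq hI)
    set J := I ⊔ Ideal.span {(m : S)}
    set L := I ⊔ Ideal.span {(n : S)}
    have hN : Ideal.absNorm J * Ideal.absNorm L = m * n := by rw [← map_mul, hmul, hI]
    have hJ : (Ideal.absNorm J).Coprime n := Ideal.coprime_absNorm_of_mem hmn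
      (Ideal.mem_sup_right (Ideal.mem_span_singleton_self _))
    have hL : (Ideal.absNorm L).Coprime m := Ideal.coprime_absNorm_of_mem hmn.symm
      (Ideal.mem_sup_right (Ideal.mem_span_singleton_self _))
    have hJm : Ideal.absNorm J = m := Nat.dvd_antisymm
      (hJ.dvd_of_dvd_mul_right (hN ▸ dvd_mul_right _ _))
      (hL.symm.dvd_of_dvd_mul_right (hN ▸ dvd_mul_right _ _))
    have hLn : Ideal.absNorm L = n := Nat.dvd_antisymm
      (hL.dvd_of_dvd_mul_left (hN ▸ dvd_mul_left _ _))
      (hJ.symm.dvd_of_dvd_mul_left (hN ▸ dvd_mul_left _ _))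
    exact ⟨⟨⟨J, hJm⟩, ⟨L, hLn⟩⟩, Subtype.ext hmul⟩

end IdealCount

section IdealCountPrimePow

variable {S : Type*} [CommRing S] [IsDedekindDomain S] [Module.Free ℤ S]

lemma Ideal.eq_of_le_of_absNorm_prime {P M : Ideal S} (hP : (Ideal.absNorm P).Prime)
    (hPM : P ≤ M) (hM : M ≠ ⊤) : P = M := by
  obtain ⟨Q, hQ⟩ := Ideal.dvd_iff_le.mpr hPM
  have h := hP
  rw [hQ, map_mul, Nat.prime_mul_iff] at h
  rcases h with ⟨-, h⟩ | ⟨-, h⟩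
  · rw [Ideal.absNorm_eq_one_iff] at h
    rw [hQ, h, Ideal.mul_top]
  · exact absurd (Ideal.absNorm_eq_one_iff.mp h) hM

lemma Ideal.exists_le_isPrime_of_absNorm_eq_prime_pow {I : Ideal S} {r k : ℕ} (hr : r.Prime)
    (hI : Ideal.absNorm I = r ^ (k + 1)) :
    ∃ M : Ideal S, M.IsPrime ∧ I ≤ M ∧ Ideal.span {(r : S)} ≤ M := by
  have hI1 : I ≠ ⊤ := by
    rintro rfl
    rw [Ideal.absNorm_top] at hI
    exact (Nat.one_lt_pow k.succ_ne_zero hr.one_lt).ne hI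
  obtain ⟨M, hM, hIM⟩ := Ideal.exists_le_maximal I hI1
  refine ⟨M, hM.isPrime, hIM, ?_⟩
  rw [Ideal.span_singleton_le_iff_mem]
  have h : ((r ^ (k + 1) : ℕ) : S) ∈ M := hIM (Ideal.natCast_mem_of_absNorm_eq hI)
  rw [Nat.cast_pow] at h
  exact hM.isPrime.mem_of_pow_mem _ h

lemma Ideal.exists_eq_mul_of_absNorm_eq_prime_pow {r k : ℕ} (hr : r.Prime) {I P : Ideal S}
    (hP : Ideal.absNorm P = r) (hI : Ideal.absNorm I = r ^ (k + 1)) (hIP : I ≤ P) :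
    ∃ J : Ideal S, Ideal.absNorm J = r ^ k ∧ P * J = I := by
  obtain ⟨J, hJ⟩ := Ideal.dvd_iff_le.mpr hIP
  refine ⟨J, ?_, hJ.symm⟩
  have h2 := congrArg Ideal.absNorm hJ
  rw [map_mul, hP, hI, pow_succ'] at h2
  exact (Nat.eq_of_mul_eq_mul_left hr.pos h2).symm

lemma Ideal.card_absNorm_eq_one : Nat.card {I : Ideal S // Ideal.absNorm I = 1} = 1 := by
  rw [Nat.card_eq_one_iff_exists]
  exact ⟨⟨⊤, Ideal.absNorm_top⟩, fun x ↦ Subtype.ext (Ideal.absNorm_eq_one_iff.mp x.2)⟩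

variable [Module.Finite ℤ S]

instance Ideal.finite_absNorm_eq [CharZero S] (n : ℕ) :
    Finite {I : Ideal S // Ideal.absNorm I = n} :=
  (Ideal.finite_setOfPred_absNorm_eq n).to_subtype

lemma Ideal.card_absNorm_eq_prime_pow_add_two {r : ℕ} (hr : r.Prime)
    (hS : Module.finrank ℤ S = 2) (h : ∀ I : Ideal S, Ideal.absNorm I ≠ r) (k : ℕ) :
    Nat.card {I : Ideal S // Ideal.absNorm I = r ^ (k + 2)} =
      Nat.card {I : Ideal S // Ideal.absNorm I = r ^ k} := by
  have hN : Ideal.absNorm (Ideal.span {(r : S)}) = r ^ 2 := by rw [Ideal.absNorm_span_natCast, hS]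
  have hr0 : Ideal.span {(r : S)} ≠ 0 := by
    intro h0
    rw [h0, map_zero] at hN
    exact (pow_pos hr.pos 2).ne hN
  symm
  refine Nat.card_eq_of_bijective (f := fun x : {I : Ideal S // Ideal.absNorm I = r ^ k} ↦
    (⟨Ideal.span {(r : S)} * x.1, by rw [map_mul, x.2, hN]; ring⟩ :
      {I : Ideal S // Ideal.absNorm I = r ^ (k + 2)})) ⟨?_, ?_⟩
  · rintro ⟨I, hI⟩ ⟨J, hJ⟩ hIJ
    exact Subtype.ext (mul_left_cancel₀ hr0 (congrArg Subtype.val hIJ))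
  · rintro ⟨I, hI⟩
    obtain ⟨M, hM, hIM, hrM⟩ := Ideal.exists_le_isPrime_of_absNorm_eq_prime_pow hr hI
    have hMr : M = Ideal.span {(r : S)} := by
      obtain ⟨Q, hQ⟩ := Ideal.dvd_iff_le.mpr hrM
      have hd : Ideal.absNorm M ∣ r ^ 2 := hN ▸ Ideal.absNorm_dvd_absNorm_of_le hrM
      obtain ⟨i, hi, hMi⟩ := (Nat.dvd_prime_pow hr).mp hd
      interval_cases i
      · exact absurd (Ideal.absNorm_eq_one_iff.mp (by simpa using hMi)) hM.ne_top
      · exact absurd (by simpa using hMi) (h M)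
      · have h2 := congrArg Ideal.absNorm hQ
        rw [map_mul, hN, hMi] at h2
        have hQ1 : Ideal.absNorm Q = 1 := by
          have := pow_pos hr.pos 2
          nlinarith
        rw [hQ, Ideal.absNorm_eq_one_iff.mp hQ1, Ideal.mul_top]
    obtain ⟨J, hJ⟩ := Ideal.dvd_iff_le.mpr (hMr ▸ hIM)
    refine ⟨⟨J, ?_⟩, Subtype.ext hJ.symm⟩
    have h2 := congrArg Ideal.absNorm hJ
    rw [map_mul, hN, hI, pow_add, mul_comm] at h2
    exact (Nat.eq_of_mul_eq_mul_left (pow_pos hr.pos 2) h2).symm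

lemma Ideal.exists_mul_eq_span_of_absNorm_eq {r : ℕ} (hr : r.Prime)
    (hS : Module.finrank ℤ S = 2) {P : Ideal S} (hP : Ideal.absNorm P = r) :
    ∃ Q : Ideal S, Ideal.absNorm Q = r ∧ ∀ (k : ℕ) (I : Ideal S),
      Ideal.absNorm I = r ^ (k + 1) → I ≤ P ∨ I ≤ Q := by
  have hN : Ideal.absNorm (Ideal.span {(r : S)}) = r ^ 2 := by rw [Ideal.absNorm_span_natCast, hS]
  obtain ⟨Q, hQ⟩ := Ideal.dvd_iff_le.mpr ((Ideal.span_singleton_le_iff_mem P).mpr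
    (Ideal.natCast_mem_of_absNorm_eq hP))
  have hQr : Ideal.absNorm Q = r := by
    have h2 := congrArg Ideal.absNorm hQ
    rw [map_mul, hN, hP, pow_two] at h2
    exact (Nat.eq_of_mul_eq_mul_left hr.pos h2).symm
  refine ⟨Q, hQr, fun k I hI ↦ ?_⟩
  obtain ⟨M, hM, hIM, hrM⟩ := Ideal.exists_le_isPrime_of_absNorm_eq_prime_pow hr hI
  rw [hQ] at hrM
  rcases hM.mul_le.mp hrM with h | h
  · exact Or.inl (Ideal.eq_of_le_of_absNorm_prime (hP ▸ hr) h hM.ne_top ▸ hIM)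
  · exact Or.inr (Ideal.eq_of_le_of_absNorm_prime (hQr ▸ hr) h hM.ne_top ▸ hIM)

lemma Ideal.card_absNorm_eq_prime_pow_succ_of_unique {r : ℕ} (hr : r.Prime)
    (hS : Module.finrank ℤ S = 2) {P : Ideal S} (hP : Ideal.absNorm P = r)
    (h : ∀ I : Ideal S, Ideal.absNorm I = r → I = P) (k : ℕ) :
    Nat.card {I : Ideal S // Ideal.absNorm I = r ^ (k + 1)} =
      Nat.card {I : Ideal S // Ideal.absNorm I = r ^ k} := by
  have hP0 : P ≠ 0 := by
    rintro rfl
    rw [map_zero] at hP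
    exact hr.pos.ne hP
  obtain ⟨Q, hQ, hPQ⟩ := Ideal.exists_mul_eq_span_of_absNorm_eq hr hS hP
  symm
  refine Nat.card_eq_of_bijective (f := fun x : {I : Ideal S // Ideal.absNorm I = r ^ k} ↦
    (⟨P * x.1, by rw [map_mul, x.2, hP]; ring⟩ :
      {I : Ideal S // Ideal.absNorm I = r ^ (k + 1)})) ⟨?_, ?_⟩
  · rintro ⟨I, hI⟩ ⟨J, hJ⟩ hIJ
    exact Subtype.ext (mul_left_cancel₀ hP0 (congrArg Subtype.val hIJ))
  · rintro ⟨I, hI⟩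
    have hIP : I ≤ P := by
      rcases hPQ k I hI with h' | h'
      · exact h'
      · exact h Q hQ ▸ h'
    obtain ⟨J, hJ, hJI⟩ := Ideal.exists_eq_mul_of_absNorm_eq_prime_pow hr hP hI hIP
    exact ⟨⟨J, hJ⟩, Subtype.ext hJI⟩

lemma Ideal.card_absNorm_eq_prime_pow_succ_of_ne [CharZero S] {r : ℕ} (hr : r.Prime)
    (hS : Module.finrank ℤ S = 2) {P P' : Ideal S} (hP : Ideal.absNorm P = r)
    (hP' : Ideal.absNorm P' = r) (hne : P' ≠ P) (k : ℕ) :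
    Nat.card {I : Ideal S // Ideal.absNorm I = r ^ (k + 1)} =
      Nat.card {I : Ideal S // Ideal.absNorm I = r ^ k} + 1 := by
  have htop {J : Ideal S} (hJ : Ideal.absNorm J = r) : J ≠ ⊤ := by
    rintro rfl
    rw [Ideal.absNorm_top] at hJ
    exact hr.one_lt.ne hJ
  have hP0 : P ≠ 0 := by
    rintro rfl
    rw [map_zero] at hP
    exact hr.pos.ne hP
  obtain ⟨Q, hQ, hPQ⟩ := Ideal.exists_mul_eq_span_of_absNorm_eq hr hS hP
  have hQP : P' = Q := by
    rcases hPQ 0 P' (by simpa using hP') with h | h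
    · exact absurd (Ideal.eq_of_le_of_absNorm_prime (hP' ▸ hr) h (htop hP)) hne
    · exact Ideal.eq_of_le_of_absNorm_prime (hP' ▸ hr) h (htop hQ)
  subst hQP
  have hPprime : P.IsPrime :=
    Ideal.isPrime_of_irreducible_absNorm (by rw [hP]; exact hr)
  have hQk (k : ℕ) : ¬ P' ^ k ≤ P := by
    intro h
    exact hne (Ideal.eq_of_le_of_absNorm_prime (hP' ▸ hr) (hPprime.le_of_pow_le h) (htop hP))
  have huniq (k : ℕ) : ∀ I : Ideal S, Ideal.absNorm I = r ^ k → ¬ I ≤ P → I = P' ^ k := by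
    induction k with
    | zero =>
      intro I hI _
      rw [pow_zero, Ideal.one_eq_top]
      exact Ideal.absNorm_eq_one_iff.mp (by simpa using hI)
    | succ k ih =>
      intro I hI hIP
      obtain ⟨J, hJ, hJI⟩ := Ideal.exists_eq_mul_of_absNorm_eq_prime_pow hr hP' hI
        ((hPQ k I hI).resolve_left hIP)
      have hJP : ¬ J ≤ P := fun h ↦ hIP (by
        rw [← hJI]; exact Ideal.mul_le_right.trans h)
      rw [← hJI, ih J hJ hJP, pow_succ']
  rw [← Finite.card_option]
  symm
  refine Nat.card_eq_of_bijective
    (f := fun x : Option {I : Ideal S // Ideal.absNorm I = r ^ k} ↦ x.elim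
      (⟨P' ^ (k + 1), by rw [map_pow, hP']⟩ : {I : Ideal S // Ideal.absNorm I = r ^ (k + 1)})
      fun x ↦ ⟨P * x.1, by rw [map_mul, x.2, hP]; ring⟩) ⟨?_, ?_⟩
  · rintro (_ | ⟨I, hI⟩) (_ | ⟨J, hJ⟩) hIJ
    · rfl
    · have h : P' ^ (k + 1) = P * J := congrArg Subtype.val hIJ
      exact absurd (h.trans_le Ideal.mul_le_left) (hQk _)
    · have h : P * I = P' ^ (k + 1) := congrArg Subtype.val hIJ
      exact absurd (h.symm.trans_le Ideal.mul_le_left) (hQk _)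
    · exact congrArg some (Subtype.ext (mul_left_cancel₀ hP0 (congrArg Subtype.val hIJ)))
  · rintro ⟨I, hI⟩
    by_cases hIP : I ≤ P
    · obtain ⟨J, hJ, hJI⟩ := Ideal.exists_eq_mul_of_absNorm_eq_prime_pow hr hP hI hIP
      exact ⟨some ⟨J, hJ⟩, Subtype.ext hJI⟩
    · exact ⟨none, Subtype.ext (huniq _ I hI hIP).symm⟩

lemma Ideal.card_absNorm_eq_prime_pow [CharZero S] {r : ℕ} (hr : r.Prime)
    (hS : Module.finrank ℤ S = 2) {ε : ℤ} (hε : ε = 0 ∨ ε = 1 ∨ ε = -1)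
    (h : (Nat.card {I : Ideal S // Ideal.absNorm I = r} : ℤ) = 1 + ε) (k : ℕ) :
    (Nat.card {I : Ideal S // Ideal.absNorm I = r ^ k} : ℤ) =
      ∑ i ∈ Finset.range (k + 1), ε ^ i := by
  have h0 : (Nat.card {I : Ideal S // Ideal.absNorm I = r ^ 0} : ℤ) = 1 := by
    rw [pow_zero, Ideal.card_absNorm_eq_one, Nat.cast_one]
  rcases hε with rfl | rfl | rfl
  · have h1 : Nat.card {I : Ideal S // Ideal.absNorm I = r} = 1 := by exact_mod_cast h
    obtain ⟨⟨P, hP⟩, hu⟩ := Nat.card_eq_one_iff_exists.mp h1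
    induction k with
    | zero => simp
    | succ k ih =>
      rw [Ideal.card_absNorm_eq_prime_pow_succ_of_unique hr hS hP
        (fun I hI ↦ congrArg Subtype.val (hu ⟨I, hI⟩)), ih, Finset.sum_range_succ _ (k + 1)]
      simp
  · have h1 : Nat.card {I : Ideal S // Ideal.absNorm I = r} = 2 := by exact_mod_cast h
    obtain ⟨⟨P, hP⟩, ⟨Q, hQ⟩, hPQ, -⟩ := Nat.card_eq_two_iff.mp h1
    induction k with
    | zero => simp
    | succ k ih =>
      rw [Ideal.card_absNorm_eq_prime_pow_succ_of_ne hr hS hP hQ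
        (fun h ↦ hPQ (Subtype.ext h.symm)), Nat.cast_add, ih]
      simp
  · have h1 : Nat.card {I : Ideal S // Ideal.absNorm I = r} = 0 := by omega
    have hI : ∀ I : Ideal S, Ideal.absNorm I ≠ r := fun I hI ↦
      (Finite.card_eq_zero_iff.mp h1).false ⟨I, hI⟩
    induction k using Nat.twoStepInduction with
    | zero => simp
    | one => rw [pow_one, h1]; simp [Finset.sum_range_succ]
    | more k ih _ =>
      rw [Ideal.card_absNorm_eq_prime_pow_add_two hr hS hI, ih, Finset.sum_range_succ _ (k + 2),
        Finset.sum_range_succ _ (k + 1)]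
      ring

end IdealCountPrimePow

section QuadraticOrder

variable {S : Type*} [CommRing S] {ω : S} {c : ℕ}

lemma eq_zero_of_intCast_add_intCast_mul_eq_zero [CharZero S] (hc : 0 < c)
    (hω : ω * ω = ω - c) {m n : ℤ} (h : (m : S) + n * ω = 0) : m = 0 ∧ n = 0 := by
  have h1 : m ^ 2 + m * n + n ^ 2 * c = 0 := by
    have : ((m ^ 2 + m * n + n ^ 2 * c : ℤ) : S) = 0 := by
      push_cast
      linear_combination ((m : S) - n * ω + n) * h + (n : S) ^ 2 * hω
    exact_mod_cast this
  have hc' : (1 : ℤ) ≤ c := by exact_mod_cast hc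
  have hn : n = 0 := by
    by_contra hn
    have := pow_pos (abs_pos.mpr hn) 2
    rw [sq_abs] at this
    nlinarith [sq_nonneg (2 * m + n), sq_nonneg n]
  subst hn
  simpa using h1

lemma exists_ringHom_zmod_apply_eq [CharZero S] (hc : 0 < c) (hω : ω * ω = ω - c)
    (hS : ∀ x : S, ∃ m n : ℤ, x = m + n * ω) {r : ℕ} {u : ZMod r} (hu : u * u = u - c) :
    ∃ φ : S →+* ZMod r, φ ω = u := by
  let e : QuadraticAlgebra ℤ (-(c : ℤ)) 1 →ₐ[ℤ] S :=
    QuadraticAlgebra.lift ⟨ω, by rw [hω]; simp; ring⟩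
  have he (z : QuadraticAlgebra ℤ (-(c : ℤ)) 1) : e z = z.re + z.im * ω := by
    simp [e, QuadraticAlgebra.lift]
  let v : QuadraticAlgebra ℤ (-(c : ℤ)) 1 →ₐ[ℤ] ZMod r :=
    QuadraticAlgebra.lift ⟨u, by rw [hu]; simp; ring⟩
  have hv (z : QuadraticAlgebra ℤ (-(c : ℤ)) 1) : v z = z.re + z.im * u := by
    simp [v, QuadraticAlgebra.lift]
  have hbij : Function.Bijective e := by
    refine ⟨(injective_iff_map_eq_zero e).mpr fun z hz ↦ ?_, fun x ↦ ?_⟩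
    · rw [he] at hz
      obtain ⟨h1, h2⟩ := eq_zero_of_intCast_add_intCast_mul_eq_zero hc hω hz
      exact QuadraticAlgebra.ext h1 h2
    · obtain ⟨m, n, rfl⟩ := hS x
      exact ⟨⟨m, n⟩, he _⟩
  let E := AlgEquiv.ofBijective e hbij
  refine ⟨v.toRingHom.comp E.symm.toRingEquiv.toRingHom, ?_⟩
  have h1 : E.symm ω = ⟨0, 1⟩ := by
    rw [AlgEquiv.symm_apply_eq]
    change ω = e _
    rw [he]
    simp
  change v (E.symm ω) = u
  rw [h1, hv]
  simp

lemma Ideal.card_absNorm_eq_prime [CharZero S] [IsDedekindDomain S] [Module.Free ℤ S]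
    (hc : 0 < c) (hω : ω * ω = ω - c)
    (hS : ∀ x : S, ∃ m n : ℤ, x = m + n * ω) {r : ℕ} (hr : r.Prime) :
    Nat.card {I : Ideal S // Ideal.absNorm I = r} =
      Nat.card {u : ZMod r // u * u = u - c} := by
  have : NeZero r := ⟨hr.ne_zero⟩
  choose φ hφ using fun u : {u : ZMod r // u * u = u - c} ↦
    exists_ringHom_zmod_apply_eq hc hω hS u.2
  have hsurj (u) : Function.Surjective (φ u) := ZMod.ringHom_surjective _
  symm
  refine Nat.card_eq_of_bijective (f := fun u ↦ (⟨RingHom.ker (φ u), ?_⟩ :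
    {I : Ideal S // Ideal.absNorm I = r})) ⟨?_, ?_⟩
  · rw [Ideal.absNorm_apply, Submodule.cardQuot_apply]
    exact (Nat.card_congr (RingHom.quotientKerEquivOfSurjective (hsurj u)).toEquiv).trans
      (Nat.card_zmod r)
  · intro u v huv
    have hker : RingHom.ker (φ u) = RingHom.ker (φ v) := congrArg Subtype.val huv
    have h1 : ω - (u.1.val : S) ∈ RingHom.ker (φ u) := by
      rw [RingHom.mem_ker, map_sub, hφ, map_natCast, ZMod.natCast_zmod_val, sub_self]
    rw [hker, RingHom.mem_ker, map_sub, hφ, map_natCast, ZMod.natCast_zmod_val, sub_eq_zero] at h1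
    exact Subtype.ext h1.symm
  · rintro ⟨I, hI⟩
    have hcard : Nat.card (S ⧸ I) = r := by
      rw [← hI, Ideal.absNorm_apply, Submodule.cardQuot_apply]
    have : Finite (S ⧸ I) := Nat.finite_of_card_ne_zero (hcard ▸ hr.ne_zero)
    have := Fintype.ofFinite (S ⧸ I)
    let e := (ZMod.ringEquivOfPrime (S ⧸ I) hr (by rw [← Nat.card_eq_fintype_card, hcard])).symm
    let θ : S →+* ZMod r := e.toRingHom.comp (Ideal.Quotient.mk I)
    have hθ : θ ω * θ ω = θ ω - c := by rw [← map_mul, hω, map_sub, map_natCast]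
    refine ⟨⟨θ ω, hθ⟩, Subtype.ext ?_⟩
    have hφθ : φ ⟨θ ω, hθ⟩ = θ := by
      ext x
      obtain ⟨m, n, rfl⟩ := hS x
      rw [map_add, map_add, map_mul, map_mul, hφ]
      simp
    change RingHom.ker (φ ⟨θ ω, hθ⟩) = I
    rw [hφθ]
    ext x
    rw [RingHom.mem_ker, ← Ideal.Quotient.eq_zero_iff_mem]
    exact e.map_eq_zero_iff

end QuadraticOrder

section RootCount

variable {ℓ : ℕ} [Fact ℓ.Prime]

lemma legendreSym_neg_prime_of_mod_four_eq_three (hℓ4 : ℓ % 4 = 3) {r : ℕ} [Fact r.Prime]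
    (hr : r ≠ 2) : legendreSym r (-(ℓ : ℤ)) = legendreSym ℓ r := by
  have hℓ2 : ℓ ≠ 2 := by omega
  rw [neg_eq_neg_one_mul, legendreSym.mul, legendreSym.at_neg_one hr]
  have hrodd : r % 2 = 1 := (Fact.out : r.Prime).eq_two_or_odd.resolve_left hr
  rcases (by omega : r % 4 = 1 ∨ r % 4 = 3) with h | h
  · rw [ZMod.χ₄_nat_one_mod_four h, one_mul,
      legendreSym.quadratic_reciprocity_one_mod_four h hℓ2]
  · rw [ZMod.χ₄_nat_three_mod_four h, legendreSym.quadratic_reciprocity_three_mod_four h hℓ4]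
    ring

lemma card_roots_eq_one_add_legendreSym (hℓ4 : ℓ % 4 = 3) {r : ℕ} (hr : r.Prime) :
    (Nat.card {u : ZMod r // u * u = u - ((ℓ + 1) / 4 : ℕ)} : ℤ) = 1 + legendreSym ℓ r := by
  have hc : ((ℓ + 1) / 4 : ℕ) * 4 = ℓ + 1 := by omega
  by_cases hr2 : r = 2
  · subst hr2
    have h2 := legendreSym.at_two (p := ℓ) (by omega)
    rw [Nat.cast_two, h2, ZMod.χ₈_nat_eq_if_mod_eight, Nat.card_eq_fintype_card]
    rcases (by omega : ℓ % 8 = 3 ∨ ℓ % 8 = 7) with h | h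
    · have h3 : (((ℓ + 1) / 4 : ℕ) : ZMod 2) = 1 := by
        rw [ZMod.natCast_eq_one_iff_odd, Nat.odd_iff]; omega
      rw [h3, if_neg (by omega), if_neg (by omega)]
      decide
    · have h3 : (((ℓ + 1) / 4 : ℕ) : ZMod 2) = 0 := by
        rw [ZMod.natCast_eq_zero_iff_even, Nat.even_iff]; omega
      rw [h3, if_neg (by omega), if_pos (by omega)]
      decide
  · have : Fact r.Prime := ⟨hr⟩
    have hc' : (((ℓ + 1) / 4 : ℕ) : ZMod r) * 4 = ℓ + 1 := by exact_mod_cast congrArg Nat.cast hc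
    set c := (ℓ + 1) / 4
    have h20 : (2 : ZMod r) ≠ 0 := Ring.two_ne_zero (by rwa [ZMod.ringChar_zmod_n])
    have h := quadraticChar_card_sqrts (F := ZMod r) (by rwa [ZMod.ringChar_zmod_n]) (-(ℓ : ZMod r))
    have hleg := legendreSym_neg_prime_of_mod_four_eq_three hℓ4 hr2
    rw [legendreSym, Int.cast_neg, Int.cast_natCast] at hleg
    rw [hleg] at h
    rw [add_comm, ← h, Set.toFinset_card, ← Nat.card_eq_fintype_card, Nat.cast_inj]
    refine Nat.card_congr ?_
    refine Equiv.subtypeEquiv ((Equiv.mulLeft₀ 2 h20).trans (Equiv.subRight 1)) fun u ↦ ?_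
    change _ ↔ (2 * u - 1) ^ 2 = -(ℓ : ZMod r)
    constructor
    · intro hu
      linear_combination 4 * hu - hc'
    · intro hu
      have : (4 : ZMod r) ≠ 0 := by
        rw [show (4 : ZMod r) = 2 * 2 by norm_num]; exact mul_ne_zero h20 h20
      apply mul_left_cancel₀ this
      linear_combination hu + hc'

end RootCount

section DedekindZetaQuadratic

open NumberField

variable {K : Type*} [Field K] [NumberField K] {ℓ : ℕ} [Fact ℓ.Prime]

lemma card_absNorm_eq_prime_pow_legendreSym (hℓ4 : ℓ % 4 = 3)
    (hK : Module.finrank ℚ K = 2) {α : K} (hα : α ^ 2 = -(ℓ : K)) {r : ℕ} (hr : r.Prime)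
    (k : ℕ) :
    (Nat.card {I : Ideal (𝓞 K) // Ideal.absNorm I = r ^ k} : ℤ) =
      ∑ i ∈ Finset.range (k + 1), legendreSym ℓ r ^ i := by
  obtain ⟨ω, hω, hS⟩ := exists_omega_ringOfIntegers Fact.out hℓ4 hK hα
  have hc : 0 < (ℓ + 1) / 4 := by omega
  refine Ideal.card_absNorm_eq_prime_pow hr (by rw [RingOfIntegers.rank, hK]) ?_ ?_ k
  · by_cases h : ((r : ℤ) : ZMod ℓ) = 0
    · exact Or.inl ((legendreSym.eq_zero_iff ℓ r).mpr h)
    · exact Or.inr (legendreSym.eq_one_or_neg_one ℓ h)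
  · rw [Ideal.card_absNorm_eq_prime hc hω hS hr, card_roots_eq_one_add_legendreSym hℓ4 hr]

variable (K) in
/-- The number of ideals of a given nonzero norm, as an arithmetic function. -/
noncomputable def idealNormCount : ArithmeticFunction ℂ :=
  ⟨fun n ↦ if n = 0 then 0 else (Nat.card {I : Ideal (𝓞 K) // Ideal.absNorm I = n} : ℂ), if_pos rfl⟩

lemma idealNormCount_apply {n : ℕ} (hn : n ≠ 0) :
    idealNormCount K n = (Nat.card {I : Ideal (𝓞 K) // Ideal.absNorm I = n} : ℂ) := if_neg hn

lemma isMultiplicative_idealNormCount : (idealNormCount K).IsMultiplicative := by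
  rw [ArithmeticFunction.IsMultiplicative.iff_ne_zero]
  refine ⟨?_, fun {m n} hm hn hmn ↦ ?_⟩
  · rw [idealNormCount_apply one_ne_zero, Ideal.card_absNorm_eq_one, Nat.cast_one]
  · rw [idealNormCount_apply hm, idealNormCount_apply hn, idealNormCount_apply (mul_ne_zero hm hn),
      Ideal.card_absNorm_eq_mul_of_coprime hmn, Nat.cast_mul]

variable (ℓ) in
/-- The Legendre symbol modulo `ℓ`, as an arithmetic function. -/
noncomputable def legendreArithmeticFunction : ArithmeticFunction ℂ :=
  ⟨fun n ↦ (legendreSym ℓ n : ℂ), by simp⟩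

lemma legendreArithmeticFunction_apply (n : ℕ) :
    legendreArithmeticFunction ℓ n = (legendreSym ℓ n : ℂ) := rfl

lemma isMultiplicative_legendreArithmeticFunction :
    (legendreArithmeticFunction ℓ).IsMultiplicative := by
  refine ⟨?_, fun {m n} _ ↦ ?_⟩
  · rw [legendreArithmeticFunction_apply]; simp
  · simp only [legendreArithmeticFunction_apply]
    rw [Nat.cast_mul, legendreSym.mul, Int.cast_mul]

lemma idealNormCount_eq (hℓ4 : ℓ % 4 = 3)
    (hK : Module.finrank ℚ K = 2) {α : K} (hα : α ^ 2 = -(ℓ : K)) :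
    idealNormCount K =
      legendreArithmeticFunction ℓ * (ArithmeticFunction.zeta : ArithmeticFunction ℂ) := by
  rw [ArithmeticFunction.IsMultiplicative.eq_iff_eq_on_prime_powers _
    isMultiplicative_idealNormCount _ (isMultiplicative_legendreArithmeticFunction.mul
      ArithmeticFunction.isMultiplicative_zeta.natCast)]
  intro r k hr
  rw [idealNormCount_apply (pow_pos hr.pos k).ne', ArithmeticFunction.coe_mul_zeta_apply,
    Nat.divisors_prime_pow hr, Finset.sum_map]
  have h := congrArg (Int.cast : ℤ → ℂ) (card_absNorm_eq_prime_pow_legendreSym hℓ4 hK hα hr k)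
  rw [Int.cast_natCast] at h
  rw [h, Int.cast_sum]
  refine Finset.sum_congr rfl fun i _ ↦ ?_
  change _ = ((legendreSym ℓ ((r ^ i : ℕ) : ℤ) : ℤ) : ℂ)
  rw [Nat.cast_pow]
  exact congrArg _ (map_pow (legendreSym.hom ℓ) (r : ℤ) i).symm

lemma dedekindZeta_eq_LFunction_mul_riemannZeta (hℓ4 : ℓ % 4 = 3)
    (hK : Module.finrank ℚ K = 2) {α : K} (hα : α ^ 2 = -(ℓ : K)) {s : ℂ} (hs : 1 < s.re) :
    dedekindZeta K s = DirichletCharacter.LFunction (legendreCharacter ℓ) s * riemannZeta s := by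
  have hleg : (fun n ↦ legendreArithmeticFunction ℓ n : ℕ → ℂ) =
      fun n : ℕ ↦ legendreCharacter ℓ n := by
    ext n
    rw [legendreArithmeticFunction_apply, legendreCharacter_natCast]
  have h1 : dedekindZeta K s = LSeries (fun n ↦ idealNormCount K n) s := by
    refine LSeries_congr (fun {n} hn ↦ ?_) s
    exact (idealNormCount_apply hn).symm
  rw [h1, idealNormCount_eq hℓ4 hK hα, ArithmeticFunction.LSeries_mul']
  · rw [hleg, DirichletCharacter.LFunction_eq_LSeries _ hs]
    congr 1
    exact ArithmeticFunction.LSeries_zeta_eq_riemannZeta hs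
  · rw [hleg]
    exact DirichletCharacter.LSeriesSummable_of_one_lt_re _ hs
  · exact ArithmeticFunction.LSeriesSummable_zeta_iff.mpr hs

open Filter Topology in
lemma dedekindZeta_residue_eq_LFunction_one (hℓ4 : ℓ % 4 = 3)
    (hK : Module.finrank ℚ K = 2) {α : K} (hα : α ^ 2 = -(ℓ : K)) :
    ((dedekindZeta_residue K : ℝ) : ℂ) = DirichletCharacter.LFunction (legendreCharacter ℓ) 1 := by
  have h1 := tendsto_sub_one_mul_dedekindZeta_nhdsGT K
  have hof : Tendsto (fun s : ℝ ↦ (s : ℂ)) (𝓝[>] 1) (𝓝[≠] 1) := by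
    refine tendsto_nhdsWithin_iff.mpr ⟨?_, ?_⟩
    · exact (Complex.continuous_ofReal.tendsto 1).mono_left nhdsWithin_le_nhds
    · filter_upwards [self_mem_nhdsWithin] with s hs
      have : (1 : ℝ) < s := hs
      simpa using this.ne'
  have hL : Tendsto (DirichletCharacter.LFunction (legendreCharacter ℓ)) (𝓝[≠] 1)
      (𝓝 (DirichletCharacter.LFunction (legendreCharacter ℓ) 1)) :=
    ((DirichletCharacter.differentiable_LFunction
      (legendreCharacter_ne_one (by omega))).continuous.tendsto 1).mono_left nhdsWithin_le_nhds
  have h2 := (hL.mul riemannZeta_residue_one).comp hof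
  rw [mul_one] at h2
  refine tendsto_nhds_unique h1 (h2.congr' ?_)
  filter_upwards [self_mem_nhdsWithin] with s hs
  have hs : 1 < (s : ℂ).re := hs
  simp only [Function.comp]
  rw [dedekindZeta_eq_LFunction_mul_riemannZeta hℓ4 hK hα hs]
  ring

end DedekindZetaQuadratic

section ImaginaryQuadraticInvariants

open NumberField

lemma Complex.re_im_of_mul_self_eq_sub {z : ℂ} {c : ℕ} (hc : 0 < c) (hz : z * z = z - c) :
    2 * z.re = 1 ∧ z.im ^ 2 = c - 1 / 4 := by
  have hre := congrArg Complex.re hz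
  have him := congrArg Complex.im hz
  simp only [Complex.mul_re, Complex.mul_im, Complex.sub_re, Complex.sub_im, Complex.natCast_re,
    Complex.natCast_im] at hre him
  have hc' : (1 : ℝ) ≤ c := by exact_mod_cast hc
  have h : z.im * (2 * z.re - 1) = 0 := by linear_combination him
  rcases mul_eq_zero.mp h with h | h
  · rw [h] at hre
    nlinarith [sq_nonneg (z.re - 1 / 2)]
  · have h2 : z.re = 1 / 2 := by linarith
    refine ⟨by linarith, ?_⟩
    rw [h2] at hre
    linear_combination -hre

variable {K : Type*} [Field K] [NumberField K] {ω : 𝓞 K} {c : ℕ}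

lemma isTotallyComplex_of_mul_self_eq (hc : 0 < c) (hω : ω * ω = ω - c) :
    IsTotallyComplex K := by
  refine ⟨fun w ↦ ?_⟩
  rw [← InfinitePlace.not_isReal_iff_isComplex, InfinitePlace.isReal_iff]
  intro h
  set φ := w.embedding
  have hz : φ ω * φ ω = φ ω - c := by
    have := congrArg (fun x : 𝓞 K ↦ φ x) hω
    simpa using this
  obtain ⟨-, h2⟩ := Complex.re_im_of_mul_self_eq_sub hc hz
  have h3 : (φ ω).im = 0 := Complex.conj_eq_iff_im.mp (RingHom.congr_fun h ω)
  rw [h3] at h2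
  have hc' : (1 : ℝ) ≤ c := by exact_mod_cast hc
  linarith

lemma nrComplexPlaces_eq_one_of_isTotallyComplex [IsTotallyComplex K]
    (hK : Module.finrank ℚ K = 2) : InfinitePlace.nrComplexPlaces K = 1 := by
  have := IsTotallyComplex.finrank (K := K)
  omega

lemma regulator_eq_one_of_isTotallyComplex [IsTotallyComplex K]
    (hK : Module.finrank ℚ K = 2) : Units.regulator K = 1 := by
  have h1 : Fintype.card (InfinitePlace K) = 1 := by
    rw [InfinitePlace.card_eq_nrRealPlaces_add_nrComplexPlaces,
      IsTotallyComplex.nrRealPlaces_eq_zero, nrComplexPlaces_eq_one_of_isTotallyComplex hK]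
  obtain ⟨w, hw⟩ := Fintype.card_eq_one_iff.mp h1
  have hrank : Units.rank K = 0 := by rw [Units.rank, h1]
  have : IsEmpty {w' // w' ≠ w} := ⟨fun x ↦ x.2 (hw x.1)⟩
  have : IsEmpty (Fin (Units.rank K)) := by rw [hrank]; infer_instance
  have hdet {n : Type _} (_ : IsEmpty n) (_ : Fintype n) (_ : DecidableEq n) (A : Matrix n n ℝ) :
      |A.det| = 1 := by rw [Matrix.det_isEmpty, abs_one]
  rw [Units.regulator_eq_det K w (Equiv.equivOfIsEmpty _ _)]
  exact hdet ‹_› _ _ _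

lemma torsionOrder_eq_two_of_mul_self_eq (hc : 2 ≤ c) (hω : ω * ω = ω - c)
    (hS : ∀ x : 𝓞 K, ∃ m n : ℤ, x = m + n * ω) : Units.torsionOrder K = 2 := by
  have key (u : (𝓞 K)ˣ) (hu : u ∈ Units.torsion K) : u = 1 ∨ u = -1 := by
    obtain ⟨w⟩ : Nonempty (InfinitePlace K) := inferInstance
    obtain ⟨m, n, hmn⟩ := hS u
    set φ := w.embedding
    have hz : φ ω * φ ω = φ ω - c := by
      have := congrArg (fun x : 𝓞 K ↦ φ x) hω
      simpa using this
    obtain ⟨h1, h2⟩ := Complex.re_im_of_mul_self_eq_sub (by omega) hz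
    have hnorm : ‖φ (u : 𝓞 K)‖ = 1 := by
      rw [InfinitePlace.norm_embedding_eq]
      exact (Units.mem_torsion K).mp hu w
    have hφ : φ (u : 𝓞 K) = m + n * φ ω := by
      rw [hmn]; simp
    have h3 : Complex.normSq (φ (u : 𝓞 K)) = 1 := by
      rw [Complex.normSq_eq_norm_sq, hnorm, one_pow]
    rw [hφ, Complex.normSq_apply] at h3
    simp only [Complex.add_re, Complex.mul_re, Complex.add_im, Complex.mul_im, Complex.intCast_re,
      Complex.intCast_im, zero_mul, sub_zero, zero_add, add_zero] at h3
    have h4 : ((m ^ 2 + m * n + c * n ^ 2 : ℤ) : ℝ) = 1 := by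
      have h5 : (φ ω).re = 1 / 2 := by linarith
      rw [h5] at h3
      push_cast
      linear_combination h3 - (n : ℝ) ^ 2 * h2
    have h5 : m ^ 2 + m * n + c * n ^ 2 = 1 := by exact_mod_cast h4
    have hc' : (2 : ℤ) ≤ c := by exact_mod_cast hc
    have hn : n = 0 := by
      by_contra hn
      have := pow_pos (abs_pos.mpr hn) 2
      rw [sq_abs] at this
      nlinarith [sq_nonneg (2 * m + n), sq_nonneg n]
    subst hn
    have hm : m ^ 2 = 1 := by linarith
    rcases sq_eq_sq_iff_eq_or_eq_neg.mp (hm.trans (one_pow 2).symm) with h | h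
    · left; ext; simp [hmn, h]
    · right; ext; simp [hmn, h]
  rw [Units.torsionOrder, Nat.card_eq_two_iff]
  refine ⟨1, ⟨-1, neg_one_mem_torsion⟩, fun h ↦ ?_, ?_⟩
  · have h1 := congrArg (fun x : Units.torsion K ↦ ((x : (𝓞 K)ˣ) : 𝓞 K)) h
    simp only [OneMemClass.coe_one, Units.val_one, Units.val_neg] at h1
    have : ((1 : ℤ) : 𝓞 K) = ((-1 : ℤ) : 𝓞 K) := by exact_mod_cast h1
    exact absurd (Int.cast_injective this) (by decide)
  · refine Set.eq_univ_of_forall fun x ↦ ?_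
    rcases key x.1 x.2 with h | h
    · exact Or.inl (Subtype.ext h)
    · exact Or.inr (Subtype.ext h)

lemma discr_eq_of_mul_self_eq (hc : 0 < c) (hω : ω * ω = ω - c)
    (hS : ∀ x : 𝓞 K, ∃ m n : ℤ, x = m + n * ω) : discr K = 1 - 4 * c := by
  have hli : LinearIndependent ℤ ![(1 : 𝓞 K), ω] := by
    rw [LinearIndependent.pair_iff]
    intro m n h
    exact eq_zero_of_intCast_add_intCast_mul_eq_zero hc hω (by simpa using h)
  have hsp : ⊤ ≤ Submodule.span ℤ (Set.range ![(1 : 𝓞 K), ω]) := by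
    intro x _
    obtain ⟨m, n, rfl⟩ := hS x
    rw [Matrix.range_cons, Matrix.range_cons, Matrix.range_empty, Set.union_empty,
      Set.singleton_union, Submodule.mem_span_pair]
    exact ⟨m, n, by simp⟩
  let b := Module.Basis.mk hli hsp
  have hb0 : b 0 = 1 := by simp [b]
  have hb1 : b 1 = ω := by simp [b]
  have hfin : Module.finrank ℤ (𝓞 K) = 2 := by
    rw [Module.finrank_eq_card_basis b, Fintype.card_fin]
  have ht1 : Algebra.trace ℤ (𝓞 K) 1 = 2 := by
    have := Algebra.trace_algebraMap_of_basis b (1 : ℤ)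
    simpa using this
  have htω : Algebra.trace ℤ (𝓞 K) ω = 1 := by
    rw [Algebra.trace_eq_matrix_trace b, Matrix.trace_fin_two, Algebra.leftMulMatrix_eq_repr_mul,
      Algebra.leftMulMatrix_eq_repr_mul, hb0, hb1, mul_one, hω]
    have e1 : ω = b 1 := hb1.symm
    have e2 : (c : 𝓞 K) = (c : ℤ) • b 0 := by rw [hb0]; simp
    rw [e2, e1, map_sub, map_smul]
    simp
  have htc : Algebra.trace ℤ (𝓞 K) (c : 𝓞 K) = 2 * c := by
    have : (c : 𝓞 K) = (c : ℤ) • 1 := by simp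
    rw [this, map_smul, ht1, smul_eq_mul, mul_comm]
  rw [← discr_eq_discr K b, Algebra.discr_def, Matrix.det_fin_two]
  simp only [Algebra.traceMatrix_apply, Algebra.traceForm_apply, hb0, hb1, mul_one, one_mul, hω,
    map_sub, ht1, htω, htc]
  ring

lemma abs_sum_legendreSym_mul_eq {ℓ : ℕ} [Fact ℓ.Prime] (hℓ4 : ℓ % 4 = 3) (hℓ3 : 3 < ℓ)
    (hK : Module.finrank ℚ K = 2) {α : K} (hα : α ^ 2 = -(ℓ : K)) :
    |∑ r ∈ Finset.range ℓ, legendreSym ℓ r * (r : ℤ)| = ℓ * classNumber K := by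
  obtain ⟨ω, hω, hS⟩ := exists_omega_ringOfIntegers Fact.out hℓ4 hK hα
  have hc4 : ((ℓ + 1) / 4 : ℕ) * 4 = ℓ + 1 := by omega
  have hc : 2 ≤ (ℓ + 1) / 4 := by omega
  set c := (ℓ + 1) / 4
  have := isTotallyComplex_of_mul_self_eq (by omega) hω
  have hdiscr : discr K = -(ℓ : ℤ) := by
    rw [discr_eq_of_mul_self_eq (by omega) hω hS]
    have : (c : ℤ) * 4 = ℓ + 1 := by exact_mod_cast hc4
    linarith
  have hℓ0 : (0 : ℝ) < ℓ := by exact_mod_cast (by omega : 0 < ℓ)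
  have hsqrt : 0 < √(ℓ : ℝ) := Real.sqrt_pos.mpr hℓ0
  have hres : dedekindZeta_residue K = Real.pi * classNumber K / √(ℓ : ℝ) := by
    rw [dedekindZeta_residue_def, IsTotallyComplex.nrRealPlaces_eq_zero,
      nrComplexPlaces_eq_one_of_isTotallyComplex hK, regulator_eq_one_of_isTotallyComplex hK,
      torsionOrder_eq_two_of_mul_self_eq hc hω hS, hdiscr]
    push_cast
    rw [abs_neg, abs_of_pos hℓ0]
    field_simp
  have hL := norm_LFunction_legendreCharacter_one hℓ4
  rw [← dedekindZeta_residue_eq_LFunction_one hℓ4 hK hα, Complex.norm_real, Real.norm_eq_abs,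
    abs_of_pos (dedekindZeta_residue_pos K), hres, div_mul_cancel₀ _ hsqrt.ne'] at hL
  have h1 : (classNumber K : ℝ) * ℓ =
      ((|∑ r ∈ Finset.range ℓ, legendreSym ℓ r * (r : ℤ)| : ℤ) : ℝ) := by
    apply mul_left_cancel₀ Real.pi_ne_zero
    field_simp at hL
    linear_combination Real.pi * hL
  rw [mul_comm]
  exact_mod_cast h1.symm

end ImaginaryQuadraticInvariants

/-- The canonical additive character of a finite field of characteristic `p`. -/
noncomputable def canonicalAddChar (p : ℕ) [Fact p.Prime] (F : Type*) [Field F]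
    [Algebra (ZMod p) F] : AddChar F ℂ :=
  (AddChar.zmodChar p (Complex.isPrimitiveRoot_exp p (NeZero.ne p)).pow_eq_one).compAddMonoidHom
    (Algebra.trace (ZMod p) F).toAddMonoidHom

lemma canonicalAddChar_apply {p : ℕ} [Fact p.Prime] {F : Type*} [Field F] [Algebra (ZMod p) F]
    (x : F) : canonicalAddChar p F x =
      Complex.exp (2 * Real.pi * Complex.I / p) ^ (Algebra.trace (ZMod p) F x).val := rfl

open scoped Classical

noncomputable section

/-- Langevin's theorem on index-2 Gauss sums with `N = p1^m`, `p1 ≡ 3 (mod 4)`, `p1 > 3`. -/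
theorem gauss_sum_index_two_prime_power
    (p1 m N p f q : ℕ)
    (hp1 : p1.Prime) (hp1_gt : 3 < p1) (hp1_mod : p1 % 4 = 3)
    (hm : 1 ≤ m) (hN : N = p1 ^ m)
    (hp : p.Prime) (hcop : Nat.Coprime p N)
    (hf : f = orderOf (p : ZMod N)) (hf2 : 2 * f = N.totient)
    (hq : q = p ^ f)
    (F : Type) [Field F] [Fintype F] [Algebra (ZMod p) F]
    (hF : Fintype.card F = q)
    (χ : MulChar F ℂ) (hχ : orderOf χ = N)
    (K : Type) [Field K] [NumberField K]
    (hK : Module.finrank ℚ K = 2) (hKα : ∃ α : K, α ^ 2 = -(p1 : K))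
    (h h0 : ℕ) (hh : h = NumberField.classNumber K) (hh0 : h0 = (f - h) / 2) :
    ∃ b c : ℤ,
      ¬ (p : ℤ) ∣ b ∧ ¬ (p : ℤ) ∣ c ∧
      b ^ 2 + (p1 : ℤ) * c ^ 2 = 4 * (p : ℤ) ^ h ∧
      b * (p : ℤ) ^ h0 ≡ -2 [ZMOD (p1 : ℤ)] ∧
      ((∑ a : F, χ a * Complex.exp (2 * (Real.pi : ℂ) * Complex.I *
            ((Algebra.trace (ZMod p) F a).val : ℂ) / (p : ℂ)))
          = (((b : ℂ) + (c : ℂ) * Complex.I * (Real.sqrt p1 : ℂ)) / 2) * (p : ℂ) ^ h0 ∨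
       (∑ a : F, χ a * Complex.exp (2 * (Real.pi : ℂ) * Complex.I *
            ((Algebra.trace (ZMod p) F a).val : ℂ) / (p : ℂ)))
          = (((b : ℂ) - (c : ℂ) * Complex.I * (Real.sqrt p1 : ℂ)) / 2) * (p : ℂ) ^ h0) := by
  have : Fact p.Prime := ⟨hp⟩
  have : Fact p1.Prime := ⟨hp1⟩
  subst hN hq hh
  obtain ⟨α, hα⟩ := hKα
  obtain ⟨k, b, c, hk, hb, hc, hbc, hmod, hg⟩ := exists_gaussSum_eq_index_two hp1_mod hp1_gt hm hF
    hcop hf hf2 (NumberField.classNumber_pos K)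
    (abs_sum_legendreSym_mul_eq hp1_mod hp1_gt hK hα) χ hχ
    (Complex.isPrimitiveRoot_exp p hp.ne_zero) (canonicalAddChar p F) canonicalAddChar_apply
  have hk0 : h0 = k := by omega
  subst hk0
  refine ⟨b, c, hb, hc, hbc, hmod, Or.inl (Eq.trans ?_ hg)⟩
  refine Finset.sum_congr rfl fun a _ ↦ ?_
  rw [canonicalAddChar_apply, ← Complex.exp_nat_mul]
  congr 2
  ring
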